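/- Let m, n ≥ 1, let F be the free group on x_1,…,x_m, y_1,…,y_n, let A ≤ F be the (free) subgroup generated by x_1,…,x_m and B ≤ F the (free) subgroup generated by y_1,…,y_n. Let u ∈ A be an element that is not a proper power in A (i.e. there are no w ∈ A and integer k ≥ 2 with u = w^k), and let v ∈ B with v ≠ 1. Then the one-relator group G = ⟨x_1,…,x_m, y_1,…,y_n ∣ u = v⟩ is residually a finite p-group for every prime p: for every prime p and every g ∈ G with g ≠ 1, there exists a normal subgroup N ⊴ G such that g ∉ N, the quotient G/N is finite, and G/N is a p-group. -/

import Mathlib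

namespace Azarov

/-- infinite order, and centraliser of every nontrivial power is the cyclic group generated. -/
def CP {H : Type} [Group H] (g : H) : Prop :=
  (∀ m : ℤ, m ≠ 0 → g ^ m ≠ 1) ∧
    ∀ (y : H) (m : ℤ), m ≠ 0 → Commute y (g ^ m) → y ∈ Subgroup.zpowers g

section CPlemmas
variable {H : Type} [Group H]

theorem CP.zpow_inj {g : H} (hg : CP g) {a b : ℤ} (h : g ^ a = g ^ b) : a = b := by
  by_contra hne
  refine hg.1 (a - b) (sub_ne_zero.2 hne) ?_
  rw [zpow_sub, h, mul_inv_cancel]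

theorem CP.eq_or {g x : H} (hg : CP g) (hx : CP x) {m n : ℤ} (hm : m ≠ 0)
    (h : g ^ m = x ^ n) : g = x ∨ g = x⁻¹ := by
  have hn : n ≠ 0 := by
    rintro rfl
    exact hg.1 m hm (by simpa using h)
  obtain ⟨a, ha⟩ := hx.2 g n hn (by rw [← h]; exact (Commute.refl g).zpow_right m)
  obtain ⟨b, hb⟩ := hg.2 x m hm (by rw [h]; exact (Commute.refl x).zpow_right n)
  simp only at ha hb
  have h1 : x ^ (a * b) = x ^ (1 : ℤ) := by rw [zpow_mul, ha, hb, zpow_one]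
  have h2 := hx.zpow_inj h1
  rcases Int.eq_one_or_neg_one_of_mul_eq_one h2 with h3 | h3
  · left; rw [← ha, h3, zpow_one]
  · right; rw [← ha, h3, zpow_neg, zpow_one]

theorem CP.inv {g : H} (hg : CP g) : CP g⁻¹ := by
  refine ⟨fun m hm h => hg.1 m hm (by simpa using h), fun y m hm h => ?_⟩
  rw [Subgroup.zpowers_inv]
  exact hg.2 y m hm (by simpa using h)

theorem CP.conj {g : H} (hg : CP g) (y : H) : CP (y * g * y⁻¹) := by
  refine ⟨fun m hm h => hg.1 m hm (by simpa [conj_zpow] using h), fun z m hm h => ?_⟩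
  rw [conj_zpow] at h
  obtain ⟨k, hk⟩ := hg.2 (y⁻¹ * z * y) m hm (by
    have := (Commute.conj_iff (a := z) (b := y * g ^ m * y⁻¹) y⁻¹).2 h
    simpa [mul_assoc] using this)
  refine ⟨k, ?_⟩
  simp only at hk
  simp only [conj_zpow, hk]; group

/-- no inversion in torsion free groups -/
theorem CP.mem_of_conj [IsMulTorsionFree H] {x y : H} (hx : CP x) {m : ℤ} (hm : m ≠ 0)
    (h : y * x ^ m * y⁻¹ = x ^ m ∨ y * x ^ m * y⁻¹ = x ^ (-m)) : y ∈ Subgroup.zpowers x := by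
  rcases h with h | h
  · exact hx.2 y m hm (mul_inv_eq_iff_eq_mul.1 h)
  · have h2 : Commute (y * y) (x ^ m) := by
      show y * y * x ^ m = x ^ m * (y * y)
      have h' : y * x ^ m = x ^ (-m) * y := mul_inv_eq_iff_eq_mul.1 h
      have h'' : y * x ^ (-m) = x ^ m * y := by
        apply mul_inv_eq_iff_eq_mul.1
        have := congrArg (·⁻¹) h
        simpa [mul_assoc] using this
      rw [mul_assoc, h', ← mul_assoc, h'', mul_assoc]
    obtain ⟨k, hk⟩ := hx.2 (y * y) m hm h2
    simp only at hk
    have h3 : y * x ^ k * y⁻¹ = x ^ k := by rw [hk]; group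
    have h4 : (y * x ^ k * y⁻¹) ^ m = x ^ (-(m * k)) := by
      rw [conj_zpow, ← zpow_mul, mul_comm k m, zpow_mul, ← conj_zpow, h, ← zpow_mul]; ring_nf
    rw [h3, ← zpow_mul] at h4
    have h5 := hx.zpow_inj h4
    have hk0 : k = 0 := by
      have : m * k = 0 := by linarith
      rcases mul_eq_zero.1 this with h | h
      · exact absurd h hm
      · exact h
    rw [hk0, zpow_zero] at hk
    have : y = 1 := by
      have : y ^ 2 = 1 := by rw [pow_two]; exact hk.symm
      exact (pow_eq_one_iff_left (by norm_num)).1 this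
    rw [this]; exact one_mem _

theorem CP.of_injective {K : Type} [Group K] (f : K →* H) (hf : Function.Injective f) {g : K}
    (hg : CP (f g)) : CP g := by
  refine ⟨fun m hm h => hg.1 m hm (by rw [← map_zpow, h, map_one]), fun y m hm h => ?_⟩
  obtain ⟨k, hk⟩ := hg.2 (f y) m hm (by rw [← map_zpow]; exact h.map f)
  exact ⟨k, hf (by simpa using hk)⟩

theorem CP.map_equiv {K : Type} [Group K] (f : H ≃* K) {g : H} (hg : CP g) : CP (f g) := by
  apply CP.of_injective f.symm.toMonoidHom f.symm.injective
  simpa using hg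

end CPlemmas

section Free

theorem free_central {Y : Type} (z : FreeGroup Y) (hz : z ≠ 1)
    (hc : ∀ y, y * z = z * y) : Subsingleton Y := by
  classical
  by_contra hY
  rw [not_subsingleton_iff_nontrivial] at hY
  rcases hw : z.toWord with _ | ⟨⟨x, b⟩, tl⟩
  · exact hz (FreeGroup.toWord_eq_nil_iff.1 hw)
  obtain ⟨y, hy⟩ := exists_ne x
  have h1 : (FreeGroup.of y * z).toWord = (y, true) :: z.toWord := by
    rw [FreeGroup.toWord_mul, FreeGroup.toWord_of, List.singleton_append]
    apply FreeGroup.IsReduced.reduce_eq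
    have := FreeGroup.isReduced_toWord (x := z)
    rw [hw] at this ⊢
    unfold FreeGroup.IsReduced at *
    rw [List.isChain_cons_cons]
    exact ⟨fun h => absurd h hy, this⟩
  have h2 := FreeGroup.toWord_mul_sublist z (FreeGroup.of y)
  rw [← hc, h1, FreeGroup.toWord_of] at h2
  have h3 := h2.eq_of_length (by simp)
  rw [hw] at h3
  simp at h3
  exact hy h3.1.1

theorem zpowers_of_subsingleton {Y : Type} [Subsingleton Y] :
    ∃ r : FreeGroup Y, ∀ h, h ∈ Subgroup.zpowers r := by
  rcases isEmpty_or_nonempty Y with hY | ⟨⟨y⟩⟩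
  · exact ⟨1, fun h => by rw [Subsingleton.elim h 1]; exact one_mem _⟩
  · refine ⟨FreeGroup.of y, fun h => ?_⟩
    induction h using FreeGroup.induction_on with
    | C1 => exact one_mem _
    | of x => rw [Subsingleton.elim x y]; exact Subgroup.mem_zpowers _
    | inv_of x ih => exact inv_mem ih
    | mul a b ha hb => exact mul_mem ha hb

theorem centralizer_cyclic {X : Type} (z : FreeGroup X) (hz : z ≠ 1) :
    ∃ r : FreeGroup X, ∀ y, Commute y z ↔ y ∈ Subgroup.zpowers r := by
  let C := Subgroup.centralizer ({z} : Set (FreeGroup X))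
  have memC : ∀ y, y ∈ C ↔ Commute y z := fun y => by
    rw [Subgroup.mem_centralizer_singleton_iff]; rfl
  let e := IsFreeGroup.toFreeGroup C
  let z' : C := ⟨z, (memC z).2 (Commute.refl z)⟩
  have hs : Subsingleton (IsFreeGroup.Generators C) := by
    apply free_central (e z')
    · intro h
      rw [map_eq_one_iff e e.injective] at h
      exact hz (congrArg Subtype.val h)
    · intro y
      obtain ⟨y, rfl⟩ := e.surjective y
      rw [← map_mul, ← map_mul]
      congr 1
      exact Subtype.ext ((memC _).1 y.2)
  obtain ⟨r, hr⟩ := zpowers_of_subsingleton (Y := IsFreeGroup.Generators C)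
  refine ⟨(e.symm r : C), fun y => ⟨fun hy => ?_, ?_⟩⟩
  · obtain ⟨k, hk⟩ := hr (e ⟨y, (memC y).2 hy⟩)
    refine ⟨k, ?_⟩
    simp only at hk
    have := congrArg e.symm hk
    simp only [map_zpow, MulEquiv.symm_apply_apply] at this
    simpa using congrArg Subtype.val this
  · rintro ⟨k, rfl⟩
    exact ((memC _).1 (e.symm r).2).zpow_left k

theorem CP_of_root {X : Type} (z r : FreeGroup X) (hz : z ≠ 1)
    (h : ∀ y, Commute y z ↔ y ∈ Subgroup.zpowers r) : CP r := by
  have hr : r ≠ 1 := by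
    rintro rfl
    have := (h z).1 (Commute.refl z)
    simp at this
    exact hz this
  have h1 : ∀ m : ℤ, m ≠ 0 → r ^ m ≠ 1 := fun m hm hh => by
    exact hr (zpow_left_injective hm (by simpa using hh))
  refine ⟨h1, fun y m hm hy => ?_⟩
  obtain ⟨s, hs⟩ := centralizer_cyclic (r ^ m) (h1 m hm)
  obtain ⟨a, ha⟩ := (hs y).1 hy
  obtain ⟨b, hb⟩ := (hs r).1 ((Commute.refl r).zpow_right m)
  obtain ⟨c, hc⟩ := (h z).1 (Commute.refl z)
  apply (h y).1
  rw [← hc, ← hb, ← ha]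
  exact ((Commute.refl s).zpow_zpow a b).zpow_right c

theorem exists_root {X : Type} (z : FreeGroup X) (hz : z ≠ 1) :
    ∃ (r : FreeGroup X) (k : ℕ), 0 < k ∧ z = r ^ k ∧ CP r := by
  obtain ⟨r, hr⟩ := centralizer_cyclic z hz
  have hcp := CP_of_root z r hz hr
  obtain ⟨k, hk⟩ := (hr z).1 (Commute.refl z)
  simp only at hk
  have hk0 : k ≠ 0 := by rintro rfl; exact hz (by simpa using hk.symm)
  rcases lt_or_gt_of_ne hk0 with h | h
  · refine ⟨r⁻¹, k.natAbs, by omega, ?_, hcp.inv⟩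
    rw [← hk, ← zpow_natCast, inv_zpow, ← zpow_neg]
    congr 1; omega
  · refine ⟨r, k.natAbs, by omega, ?_, hcp⟩
    rw [← hk, ← zpow_natCast]
    congr 1; omega

theorem CP_of_not_power {X : Type} (z : FreeGroup X)
    (h : ¬ ∃ (w : FreeGroup X) (k : ℤ), 2 ≤ k ∧ z = w ^ k) : CP z := by
  have hz : z ≠ 1 := by rintro rfl; exact h ⟨1, 2, le_refl _, by simp⟩
  obtain ⟨r, k, hk, hz, hr⟩ := exists_root z hz
  by_cases h1 : k = 1
  · rw [hz, h1, pow_one]; exact hr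
  · exact absurd ⟨r, k, by omega, by simpa using hz⟩ h

theorem CP_of {X : Type} (x : X) : CP (FreeGroup.of x) := by
  apply CP_of_not_power
  rintro ⟨w, k, hk, h⟩
  classical
  let f : FreeGroup X →* Multiplicative ℤ := FreeGroup.lift (fun _ => Multiplicative.ofAdd 1)
  have := congrArg (fun t => (f t).toAdd) h
  simp [f] at this
  have h2 : k ∣ 1 := ⟨_, this⟩
  have := Int.le_of_dvd one_pos h2
  omega

end Free
end Azarov

namespace Azarov

/-- `P` is a finite `p`-group. -/
def FinP (p : ℕ) (P : Type) [Group P] : Prop := Finite P ∧ IsPGroup p P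

theorem finP_iff {p : ℕ} (hp : p.Prime) {P : Type} [Group P] :
    FinP p P ↔ ∃ n, Nat.card P = p ^ n := by
  have := Fact.mk hp
  constructor
  · rintro ⟨hf, h⟩
    exact IsPGroup.iff_card.1 h
  · rintro ⟨n, h⟩
    have hf : Finite P := Nat.finite_of_card_ne_zero (by rw [h]; exact pow_ne_zero _ hp.ne_zero)
    exact ⟨hf, IsPGroup.of_card h⟩

theorem FinP.prod {p : ℕ} (hp : p.Prime) {P Q : Type} [Group P] [Group Q]
    (h : FinP p P) (h' : FinP p Q) : FinP p (P × Q) := by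
  rw [finP_iff hp] at *
  obtain ⟨n, hn⟩ := h
  obtain ⟨m, hm⟩ := h'
  exact ⟨n + m, by rw [Nat.card_prod, hn, hm, pow_add]⟩

theorem FinP.pi {p : ℕ} (hp : p.Prime) {P K : Type} [Group P] [Finite K]
    (h : FinP p P) : FinP p (K → P) := by
  rw [finP_iff hp] at *
  obtain ⟨n, hn⟩ := h
  exact ⟨n * Nat.card K, by rw [Nat.card_fun, hn, pow_mul]⟩

theorem FinP.semidirect {p : ℕ} (hp : p.Prime) {P K : Type} [Group P] [Group K]
    {φ : K →* MulAut P} (h : FinP p P) (h' : FinP p K) : FinP p (P ⋊[φ] K) := by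
  rw [finP_iff hp] at *
  obtain ⟨n, hn⟩ := h
  obtain ⟨m, hm⟩ := h'
  exact ⟨n + m, by rw [SemidirectProduct.card, hn, hm, pow_add]⟩

theorem finP_zmod {p : ℕ} (hp : p.Prime) (n : ℕ) : FinP p (Multiplicative (ZMod (p ^ n))) := by
  rw [finP_iff hp]
  exact ⟨n, (Nat.card_congr Multiplicative.toAdd).trans (Nat.card_zmod _)⟩

theorem finP_zmod1 {p : ℕ} (hp : p.Prime) : FinP p (Multiplicative (ZMod p)) := by
  rw [finP_iff hp]
  exact ⟨1, ((Nat.card_congr Multiplicative.toAdd).trans (Nat.card_zmod _)).trans (pow_one p).symm⟩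

theorem FinP.coprime {p q : ℕ} (hp : p.Prime) (hq : Nat.Coprime p q) {P : Type} [Group P]
    (h : FinP p P) : (Nat.card P).Coprime q := by
  obtain ⟨n, hn⟩ := (finP_iff hp).1 h
  rw [hn]; exact Nat.Coprime.pow_left n hq

/-- the action of `K` on functions `K → P` -/
def wrAct (P K : Type) [Group P] [Group K] : K →* MulAut (K → P) where
  toFun k :=
    { toFun := fun f i => f (i * k)
      invFun := fun f i => f (i * k⁻¹)
      left_inv := fun f => by funext i; simp
      right_inv := fun f => by funext i; simp
      map_mul' := fun f g => rfl }
  map_one' := by ext f i; simp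
  map_mul' k l := by ext f i; simp [mul_assoc]

/-- wreath product -/
abbrev Wr (P K : Type) [Group P] [Group K] : Type := (K → P) ⋊[wrAct P K] K

@[simp] theorem wrAct_apply {P K : Type} [Group P] [Group K] (k : K) (f : K → P) (i : K) :
    wrAct P K k f i = f (i * k) := rfl

theorem wr_mul_left {P K : Type} [Group P] [Group K] (a b : Wr P K) (i : K) :
    (a * b).left i = a.left i * b.left (i * a.right) := by
  simp

theorem FinP.wr {p : ℕ} (hp : p.Prime) {P K : Type} [Group P] [Group K]
    (h : FinP p P) (h' : FinP p K) : FinP p (Wr P K) := by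
  have := h'.1
  exact FinP.semidirect hp (h.pi hp) ‹FinP p K›

/-- functoriality of wreath products -/
def wrMap {P Q : Type} (K : Type) [Group P] [Group Q] [Group K] (f : P →* Q) : Wr P K →* Wr Q K :=
  SemidirectProduct.map (MonoidHom.compLeft f K) (MonoidHom.id K) (fun k => by ext; rfl)

@[simp] theorem wrMap_left {P Q K : Type} [Group P] [Group Q] [Group K] (f : P →* Q) (a : Wr P K)
    (i : K) : (wrMap K f a).left i = f (a.left i) := rfl

@[simp] theorem wrMap_right {P Q K : Type} [Group P] [Group Q] [Group K] (f : P →* Q) (a : Wr P K) :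
    (wrMap K f a).right = a.right := rfl

/-- `q`-th roots in finite groups of order coprime to `q`. -/
noncomputable def rt {P : Type} [Group P] (q : ℕ) (x : P) : P := x ^ (Nat.card P).gcdB q

section rt
variable {P : Type} [Group P] {q : ℕ}

theorem rt_pow (h : (Nat.card P).Coprime q) (x : P) : rt q x ^ q = x :=
  (powCoprime h).right_inv x

theorem rt_unique (h : (Nat.card P).Coprime q) {x y : P} (hy : y ^ q = x) : rt q x = y := by
  rw [← hy]; exact (powCoprime h).left_inv y

theorem rt_map {Q : Type} [Group Q] (f : P →* Q) (h : (Nat.card P).Coprime q)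
    (h' : (Nat.card Q).Coprime q) (x : P) : rt q (f x) = f (rt q x) :=
  rt_unique h' (by rw [← map_pow, rt_pow h])

theorem rt_conj (y x : P) : rt q (y * x * y⁻¹) = y * rt q x * y⁻¹ := by
  simp only [rt, conj_zpow]

theorem rt_zpow (x : P) (k : ℤ) : rt q (x ^ k) = rt q x ^ k := by
  simp only [rt, ← zpow_mul, mul_comm]

theorem rt_inv (x : P) : rt q x⁻¹ = (rt q x)⁻¹ := by
  simp [rt]

end rt

/-- evaluation of a root word -/
noncomputable def ev {A P : Type} [Group A] [Group P] (q : ℕ) (φ : A →* P)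
    (L : List (A × ℤ)) (a : A) : P :=
  (L.map fun s => rt q (φ s.1) ^ s.2).prod * φ a

/-- conjugating a root word -/
def cj {A : Type} [Group A] (y : A) (L : List (A × ℤ)) : List (A × ℤ) :=
  L.map fun s => (y * s.1 * y⁻¹, s.2)

section ev
variable {A P : Type} [Group A] [Group P] {q : ℕ}

@[simp] theorem ev_nil (φ : A →* P) (a : A) : ev q φ [] a = φ a := by simp [ev]

@[simp] theorem ev_cons (φ : A →* P) (s : A × ℤ) (L : List (A × ℤ)) (a : A) :
    ev q φ (s :: L) a = rt q (φ s.1) ^ s.2 * ev q φ L a := by simp [ev, mul_assoc]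

@[simp] theorem cj_nil (y : A) : cj y [] = [] := rfl
@[simp] theorem cj_cons (y : A) (s : A × ℤ) (L : List (A × ℤ)) :
    cj y (s :: L) = (y * s.1 * y⁻¹, s.2) :: cj y L := rfl
@[simp] theorem cj_length (y : A) (L : List (A × ℤ)) : (cj y L).length = L.length := by simp [cj]

theorem ev_cj (φ : A →* P) (y : A) (L : List (A × ℤ)) (a : A) :
    ev q φ (cj y L) (y * a) = φ y * ev q φ L a := by
  induction L with
  | nil => simp
  | cons s L ih =>
    rw [cj_cons, ev_cons, ev_cons, ih]
    rw [map_mul, map_mul, map_inv, rt_conj, conj_zpow]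
    simp [mul_assoc]

theorem ev_transfer {B N W : Type} [Group B] [Group N] [Group W] (ι : N →* W) (π : N →* P)
    (Φ : A →* W) (ψ : B →* P) (c : A → B)
    (hN : (Nat.card N).Coprime q) (hW : (Nat.card W).Coprime q) (hP : (Nat.card P).Coprime q)
    (L : List (A × ℤ)) (a : A) (ha : ∃ n, ι n = Φ a ∧ π n = ψ (c a))
    (hL : ∀ s ∈ L, ∃ n, ι n = Φ s.1 ∧ π n = ψ (c s.1)) :
    ∃ n, ι n = ev q Φ L a ∧ π n = ev q ψ (L.map fun s => (c s.1, s.2)) (c a) := by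
  induction L with
  | nil => simpa using ha
  | cons s L ih =>
    obtain ⟨n, h1, h2⟩ := ih (fun s hs => hL s (List.mem_cons_of_mem _ hs))
    obtain ⟨m, h3, h4⟩ := hL s List.mem_cons_self
    refine ⟨rt q m ^ s.2 * n, ?_, ?_⟩
    · rw [ev_cons, map_mul, h1, map_zpow, ← h3, rt_map ι hN hW]
    · rw [List.map_cons, ev_cons, map_mul, h2, map_zpow, ← h4, rt_map π hN hP]

end ev

/-- the chain relation -/
def Rel {A : Type} [Group A] (s t : A × ℤ) : Prop := s.1 ≠ t.1 ∧ s.1 ≠ t.1⁻¹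

/-- admissible root words -/
def OK {A : Type} [Group A] (q : ℕ) (L : List (A × ℤ)) : Prop :=
  (∀ s ∈ L, CP s.1 ∧ ¬ (q : ℤ) ∣ s.2) ∧ L.IsChain Rel

theorem OK.nil {A : Type} [Group A] (q : ℕ) : OK q ([] : List (A × ℤ)) := by
  simp [OK]

theorem OK_cons {A : Type} [Group A] {q : ℕ} {s : A × ℤ} {L : List (A × ℤ)} :
    OK q (s :: L) ↔ CP s.1 ∧ ¬ (q : ℤ) ∣ s.2 ∧ (∀ t ∈ L.head?, Rel s t) ∧ OK q L := by
  simp only [OK, List.isChain_cons, List.forall_mem_cons]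
  tauto

theorem OK.cj {A : Type} [Group A] {q : ℕ} {L : List (A × ℤ)} (h : OK q L) (y : A) :
    OK q (cj y L) := by
  refine ⟨?_, ?_⟩
  · intro s hs
    obtain ⟨t, ht, rfl⟩ := List.mem_map.1 hs
    exact ⟨(h.1 t ht).1.conj y, (h.1 t ht).2⟩
  · refine List.isChain_map_of_isChain _ ?_ h.2
    rintro s t ⟨h1, h2⟩
    refine ⟨fun h => h1 ?_, fun h => h2 ?_⟩
    · simpa using h
    · simpa [mul_assoc] using h

theorem OK.map {A B : Type} [Group A] [Group B] {q : ℕ} {L : List (A × ℤ)} (h : OK q L)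
    (c : A → B) (j : B →* A) (hj : Function.Injective j) (hc : ∀ a, j (c a) = a) :
    OK q (L.map fun s => (c s.1, s.2)) := by
  refine ⟨?_, ?_⟩
  · intro s hs
    obtain ⟨t, ht, rfl⟩ := List.mem_map.1 hs
    refine ⟨CP.of_injective j hj ?_, (h.1 t ht).2⟩
    simpa [hc] using (h.1 t ht).1
  · refine List.isChain_map_of_isChain _ ?_ h.2
    rintro s t ⟨h1, h2⟩
    refine ⟨fun h => h1 ?_, fun h => h2 ?_⟩
    · have := congrArg j h
      simpa [hc] using this
    · have := congrArg j h
      simpa [hc] using this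

/-- detection of a root word in a finite `p`-group -/
def Det {A : Type} [Group A] (p q : ℕ) (L : List (A × ℤ)) (a : A) : Prop :=
  ∃ (P : Type) (_ : Group P) (φ : A →* P), FinP p P ∧ ev q φ L a ≠ 1

end Azarov

namespace Azarov

theorem ev_map {A B P : Type} [Group A] [Group B] [Group P] (q : ℕ) (f : A →* B) (φ : B →* P)
    (L : List (A × ℤ)) (a : A) :
    ev q (φ.comp f) L a = ev q φ (L.map fun s => (f s.1, s.2)) (f a) := by
  induction L with
  | nil => simp
  | cons s L ih => simp [ih]

section Schreier
variable {X : Type} {p : ℕ} (χ : FreeGroup X →* Multiplicative (ZMod p)) (x0 : X)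

/-- Schreier generators -/
abbrev SY (p : ℕ) (x0 : X) : Type :=
  {t : Multiplicative (ZMod p) × X // ¬ (t.2 = x0 ∧ t.1 ≠ Multiplicative.ofAdd (-1))}

open Classical in
/-- Schreier generator -/
noncomputable def sg (i : Multiplicative (ZMod p)) (x : X) : FreeGroup (SY p x0) :=
  if h : (x = x0 ∧ i ≠ Multiplicative.ofAdd (-1)) then 1 else FreeGroup.of ⟨(i, x), h⟩

/-- rewriting homomorphism -/
noncomputable def bigTheta : FreeGroup X →* Wr (FreeGroup (SY p x0)) (Multiplicative (ZMod p)) :=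
  FreeGroup.lift (fun x => ⟨fun i => sg x0 i x, χ (FreeGroup.of x)⟩)

theorem bigTheta_right (w : FreeGroup X) : (bigTheta χ x0 w).right = χ w := by
  have : SemidirectProduct.rightHom.comp (bigTheta χ x0) = χ := by
    ext x; simp [bigTheta]
  exact DFunLike.congr_fun this w

/-- Schreier rewriting -/
noncomputable def th (w : FreeGroup X) (i : Multiplicative (ZMod p)) : FreeGroup (SY p x0) :=
  (bigTheta χ x0 w).left i

theorem th_mul (w w' : FreeGroup X) (i : Multiplicative (ZMod p)) :
    th χ x0 (w * w') i = th χ x0 w i * th χ x0 w' (i * χ w) := by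
  simp only [th, map_mul]
  rw [wr_mul_left, bigTheta_right]

@[simp] theorem th_one (i : Multiplicative (ZMod p)) : th χ x0 1 i = 1 := by
  simp [th]

theorem th_of (x : X) (i : Multiplicative (ZMod p)) : th χ x0 (FreeGroup.of x) i = sg x0 i x := by
  simp [th, bigTheta]

theorem th_inv (w : FreeGroup X) (i : Multiplicative (ZMod p)) :
    th χ x0 w⁻¹ i = (th χ x0 w (i * (χ w)⁻¹))⁻¹ := by
  have := th_mul χ x0 w⁻¹ w i
  rw [inv_mul_cancel, th_one, map_inv] at this
  exact eq_inv_of_mul_eq_one_left this.symm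

/-- transversal -/
def tv (i : Multiplicative (ZMod p)) : FreeGroup X := FreeGroup.of x0 ^ (i.toAdd).val

/-- inverse rewriting -/
def io : FreeGroup (SY p x0) →* FreeGroup X :=
  FreeGroup.lift fun y => tv x0 y.1.1 * FreeGroup.of y.1.2 * (tv x0 (y.1.1 * χ (FreeGroup.of y.1.2)))⁻¹

/-- comparison hom -/
def bigPsi : FreeGroup X →* Wr (FreeGroup X) (Multiplicative (ZMod p)) where
  toFun w := ⟨fun i => tv x0 i * w * (tv x0 (i * χ w))⁻¹, χ w⟩
  map_one' := by ext <;> simp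
  map_mul' a b := by ext <;> simp [mul_assoc]



theorem tv_chi (hp : p.Prime) (h0 : χ (FreeGroup.of x0) = Multiplicative.ofAdd 1) (i : Multiplicative (ZMod p)) : χ (tv x0 i) = i := by
  have : NeZero p := ⟨hp.ne_zero⟩
  rw [tv, map_pow, h0, ← ofAdd_nsmul]
  simp

theorem tv_succ (hp : p.Prime) (i : Multiplicative (ZMod p)) (hi : i ≠ Multiplicative.ofAdd (-1)) :
    tv x0 i * FreeGroup.of x0 = tv x0 (i * Multiplicative.ofAdd 1) := by
  have : NeZero p := ⟨hp.ne_zero⟩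
  have : Fact (1 < p) := ⟨hp.one_lt⟩
  have h1 : (i.toAdd + 1).val = i.toAdd.val + 1 := by
    rw [ZMod.val_add_of_lt, ZMod.val_one]
    rw [ZMod.val_one]
    have h2 := ZMod.val_lt i.toAdd
    rcases Nat.lt_or_ge (i.toAdd.val + 1) p with h | h
    · exact h
    · exfalso
      have h3 : i.toAdd.val + 1 = p := by omega
      have h4 := congrArg (Nat.cast : ℕ → ZMod p) h3
      simp only [Nat.cast_add, ZMod.natCast_val, ZMod.cast_id', id, Nat.cast_one,
        CharP.cast_eq_zero] at h4
      apply hi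
      have : i.toAdd = -1 := eq_neg_of_add_eq_zero_left h4
      rw [← this]; rfl
  rw [tv, tv, toAdd_mul, toAdd_ofAdd, h1, pow_succ]

theorem io_th (hp : p.Prime) (h0 : χ (FreeGroup.of x0) = Multiplicative.ofAdd 1) (w : FreeGroup X) (i : Multiplicative (ZMod p)) :
    io χ x0 (th χ x0 w i) = tv x0 i * w * (tv x0 (i * χ w))⁻¹ := by
  have : (wrMap _ (io χ x0)).comp (bigTheta χ x0) = bigPsi χ x0 := by
    apply FreeGroup.ext_hom
    intro x
    apply SemidirectProduct.ext
    · funext i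
      rw [MonoidHom.comp_apply, wrMap_left]
      change io χ x0 (th χ x0 _ i) = tv x0 i * _ * (tv x0 (i * χ _))⁻¹
      rw [th_of, sg]
      split_ifs with h
      · rw [map_one, h.1, h0, ← tv_succ x0 hp i h.2]; simp
      · simp [io]
    · simp only [MonoidHom.comp_apply, wrMap_right, bigTheta_right]
      rfl
  have := congrArg (fun t : Wr (FreeGroup X) (Multiplicative (ZMod p)) => t.left i)
    (DFunLike.congr_fun this w)
  exact this

theorem th_tv (hp : p.Prime) (h0 : χ (FreeGroup.of x0) = Multiplicative.ofAdd 1) (i : Multiplicative (ZMod p)) : th χ x0 (tv x0 i) 1 = 1 := by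
  have : NeZero p := ⟨hp.ne_zero⟩
  have key : ∀ n : ℕ, n < p → th χ x0 (FreeGroup.of x0 ^ n) 1 = 1 := by
    intro n
    induction n with
    | zero => simp
    | succ n ih =>
      intro hn
      rw [pow_succ, th_mul, ih (by omega), one_mul, one_mul, th_of, sg, dif_pos]
      refine ⟨rfl, ?_⟩
      rw [map_pow, h0, ← ofAdd_nsmul]
      intro h
      have h := Multiplicative.ofAdd.injective h
      rw [nsmul_one] at h
      have h2 : ((n + 1 : ℕ) : ZMod p) = 0 := by rw [Nat.cast_add, h]; simp
      rw [ZMod.natCast_eq_zero_iff] at h2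
      have := Nat.le_of_dvd (by omega) h2
      omega
  exact key _ (ZMod.val_lt _)

theorem chi_io (hp : p.Prime) (h0 : χ (FreeGroup.of x0) = Multiplicative.ofAdd 1) (y : FreeGroup (SY p x0)) : χ (io χ x0 y) = 1 := by
  have : χ.comp (io χ x0) = 1 := by
    ext y
    simp [io, tv_chi χ x0 hp h0]
  exact DFunLike.congr_fun this y

theorem th_io (hp : p.Prime) (h0 : χ (FreeGroup.of x0) = Multiplicative.ofAdd 1) (y : FreeGroup (SY p x0)) : th χ x0 (io χ x0 y) 1 = y := by
  let f : FreeGroup (SY p x0) →* FreeGroup (SY p x0) :=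
    { toFun := fun y => th χ x0 (io χ x0 y) 1
      map_one' := by simp
      map_mul' := fun a b => by rw [map_mul, th_mul, chi_io χ x0 hp h0, mul_one] }
  have : f = MonoidHom.id _ := by
    apply FreeGroup.ext_hom
    rintro ⟨⟨i, x⟩, h⟩
    change th χ x0 (io χ x0 _) 1 = _
    simp only [io, FreeGroup.lift_apply_of, MonoidHom.id_apply]
    rw [th_mul, th_mul, th_tv χ x0 hp h0, th_inv, map_mul, tv_chi χ x0 hp h0, tv_chi χ x0 hp h0]
    simp only [one_mul, mul_inv_cancel]
    rw [th_tv χ x0 hp h0, th_of, sg, dif_neg h]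
    simp
  exact DFunLike.congr_fun this y

/-- pulling back -/
noncomputable def jj (hp : p.Prime) (h0 : χ (FreeGroup.of x0) = Multiplicative.ofAdd 1) (i0 : Multiplicative (ZMod p)) : FreeGroup (SY p x0) →* χ.ker where
  toFun y := ⟨(tv x0 i0)⁻¹ * io χ x0 y * tv x0 i0, by
    rw [MonoidHom.mem_ker]; simp [chi_io χ x0 hp h0]⟩
  map_one' := by ext; simp
  map_mul' a b := by ext; simp [mul_assoc]

theorem norm_sg [DecidableEq (SY p x0)] (i : Multiplicative (ZMod p)) (x : X) : (sg x0 i x).norm ≤ 1 := by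
  rw [sg]; split_ifs <;> simp

theorem norm_th_single [DecidableEq (SY p x0)] (x : X) (b : Bool) (i : Multiplicative (ZMod p)) :
    (th χ x0 (FreeGroup.mk [(x, b)]) i).norm ≤ 1 := by
  cases b with
  | true => exact (th_of χ x0 x i) ▸ norm_sg x0 i x
  | false =>
    have : (FreeGroup.mk [(x, false)]) = (FreeGroup.of x)⁻¹ := rfl
    rw [this, th_inv, FreeGroup.norm_inv_eq, th_of]
    exact norm_sg _ _ _

theorem norm_th [DecidableEq (SY p x0)] (l : List (X × Bool)) : ∀ (i : Multiplicative (ZMod p)),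
    (th χ x0 (FreeGroup.mk l) i).norm ≤ l.length := by
  induction l with
  | nil => intro i; rw [show FreeGroup.mk ([] : List (X × Bool)) = 1 from rfl]; simp
  | cons s l ih =>
    intro i
    have : FreeGroup.mk (s :: l) = FreeGroup.mk [s] * FreeGroup.mk l := by simp
    rw [this, th_mul]
    refine (FreeGroup.norm_mul_le _ _).trans ?_
    have h1 := norm_th_single χ x0 s.1 s.2 i
    have h2 := ih (i * χ (FreeGroup.mk [s]))
    simp only [List.length_cons]
    simp only [Prod.mk.eta] at h1
    omega

theorem norm_th_lt (hp : p.Prime) (h0 : χ (FreeGroup.of x0) = Multiplicative.ofAdd 1) [DecidableEq (SY p x0)] (l : List (X × Bool)) (b : Bool) (hl : (x0, b) ∈ l) :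
    ∃ i : Multiplicative (ZMod p), (th χ x0 (FreeGroup.mk l) i).norm < l.length := by
  have : Fact p.Prime := ⟨hp⟩
  have hne : (1 : Multiplicative (ZMod p)) ≠ Multiplicative.ofAdd (-1) := by
    intro h
    have h := congrArg Multiplicative.toAdd h
    simp at h
  induction l with
  | nil => simp at hl
  | cons s l ih =>
    have e : FreeGroup.mk (s :: l) = FreeGroup.mk [s] * FreeGroup.mk l := by simp
    rcases List.mem_cons.1 hl with h | h
    · subst h
      have : ∃ i, th χ x0 (FreeGroup.mk [(x0, b)]) i = 1 := by
        cases b with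
        | true =>
          refine ⟨1, ?_⟩
          change th χ x0 (FreeGroup.of x0) 1 = 1
          rw [th_of, sg, dif_pos ⟨rfl, hne⟩]
        | false =>
          refine ⟨Multiplicative.ofAdd 1, ?_⟩
          have : (FreeGroup.mk [(x0, false)]) = (FreeGroup.of x0)⁻¹ := rfl
          rw [this, th_inv, h0, mul_inv_cancel, th_of, sg, dif_pos ⟨rfl, hne⟩, inv_one]
      obtain ⟨i, hi⟩ := this
      refine ⟨i, ?_⟩
      rw [e, th_mul, hi, one_mul]
      have := norm_th χ x0 l (i * χ (FreeGroup.mk [(x0, b)]))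
      simp only [List.length_cons]
      omega
    · obtain ⟨i, hi⟩ := ih h
      refine ⟨i * (χ (FreeGroup.mk [s]))⁻¹, ?_⟩
      rw [e, th_mul]
      refine (FreeGroup.norm_mul_le _ _).trans_lt ?_
      have h1 := norm_th_single χ x0 s.1 s.2 (i * (χ (FreeGroup.mk [s]))⁻¹)
      simp only [List.length_cons, inv_mul_cancel_right]
      simp only [Prod.mk.eta] at h1
      omega

theorem schreier (hp : p.Prime) (h0 : χ (FreeGroup.of x0) = Multiplicative.ofAdd 1) (h : FreeGroup X) (hk : h ∈ χ.ker) :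
    ∃ (Y : Type) (c : χ.ker → FreeGroup Y) (j : FreeGroup Y →* χ.ker),
      Function.Injective j ∧ (∀ a, j (c a) = a) ∧
      (∀ b, (letI := Classical.decEq X; (x0, b) ∈ h.toWord) →
        letI := Classical.decEq X; letI := Classical.decEq Y; (c ⟨h, hk⟩).norm < h.norm) ∧
      (∀ q, Nat.Coprime p q → ∀ (L : List (χ.ker × ℤ)) (a : χ.ker),
        Det p q (L.map fun s => (c s.1, s.2)) (c a) →
        Det p q (L.map fun s => ((s.1 : FreeGroup X), s.2)) (a : FreeGroup X)) := by
  let _ := Classical.decEq X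
  let _ := Classical.decEq (SY p x0)
  obtain ⟨i, hi⟩ : ∃ i : Multiplicative (ZMod p), ∀ b, (x0, b) ∈ h.toWord →
      (th χ x0 h i).norm < h.norm := by
    by_cases hb : ∃ b, (x0, b) ∈ h.toWord
    · obtain ⟨b, hb⟩ := hb
      obtain ⟨i, hi⟩ := norm_th_lt χ x0 hp h0 h.toWord b hb
      rw [FreeGroup.mk_toWord] at hi
      exact ⟨i, fun _ _ => hi⟩
    · exact ⟨1, fun b hb' => absurd ⟨b, hb'⟩ hb⟩
  refine ⟨SY p x0, fun a => th χ x0 a i, jj χ x0 hp h0 i, ?_, ?_, hi, ?_⟩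
  · intro a b hab
    have := congrArg Subtype.val hab
    simp only [jj, MonoidHom.coe_mk, OneHom.coe_mk, mul_left_inj, mul_right_inj] at this
    rw [← th_io χ x0 hp h0 a, this, th_io χ x0 hp h0]
  · intro a
    apply Subtype.ext
    simp only [jj, MonoidHom.coe_mk, OneHom.coe_mk]
    rw [io_th χ x0 hp h0, (MonoidHom.mem_ker).1 a.2]
    simp [mul_assoc]
  · rintro q hq L a ⟨P, _, ψ, hP, hev⟩
    have : Fact p.Prime := ⟨hp⟩
    have hK : FinP p (Multiplicative (ZMod p)) := finP_zmod1 hp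
    have hW : FinP p (Wr P (Multiplicative (ZMod p))) := hP.wr hp hK
    have hN : FinP p (Multiplicative (ZMod p) → P) := by
      have := hK.1
      exact hP.pi hp
    refine ⟨Wr P (Multiplicative (ZMod p)), inferInstance, (wrMap _ ψ).comp (bigTheta χ x0), hW, ?_⟩
    have hcond : ∀ g : χ.ker, ∃ n : Multiplicative (ZMod p) → P,
        (SemidirectProduct.inl n : Wr P (Multiplicative (ZMod p))) =
          ((wrMap _ ψ).comp (bigTheta χ x0)).comp χ.ker.subtype g ∧
        Pi.evalMonoidHom (fun _ => P) i n = ψ (th χ x0 g i) := by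
      intro g
      refine ⟨fun i => ψ (th χ x0 g i), ?_, rfl⟩
      apply SemidirectProduct.ext
      · rfl
      · simp only [SemidirectProduct.right_inl, MonoidHom.comp_apply, wrMap_right, bigTheta_right]
        exact g.2.symm
    obtain ⟨n, h1, h2⟩ := ev_transfer (q := q) SemidirectProduct.inl
      (Pi.evalMonoidHom (fun _ => P) i)
      (((wrMap _ ψ).comp (bigTheta χ x0)).comp χ.ker.subtype) ψ (fun a : χ.ker => th χ x0 a i)
      (hN.coprime hp hq) (hW.coprime hp hq) (hP.coprime hp hq) L a (hcond a)
      (fun s _ => hcond s.1)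
    rw [ev_map] at h1
    intro h
    apply hev
    rw [← h2]
    have h3 : (SemidirectProduct.inl n : Wr P (Multiplicative (ZMod p))) = 1 := h1.trans h
    have : n = 1 := SemidirectProduct.inl_injective (by rw [h3, map_one])
    rw [this, map_one]

end Schreier
end Azarov

namespace Azarov

theorem pow_p_eq_one {p : ℕ} (x : Multiplicative (ZMod p)) : x ^ p = 1 := by
  apply Multiplicative.toAdd.injective
  simp

theorem dvd_of_zpow {p : ℕ} (hp : p.Prime) {x : Multiplicative (ZMod p)} (hx : x ≠ 1) {j : ℤ}
    (h : x ^ j = 1) : (p : ℤ) ∣ j := by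
  have : Fact p.Prime := ⟨hp⟩
  have h1 := congrArg Multiplicative.toAdd h
  simp only [toAdd_zpow, zsmul_eq_mul, toAdd_one, mul_eq_zero] at h1
  rcases h1 with h1 | h1
  · exact (ZMod.intCast_zmod_eq_zero_iff_dvd j p).1 h1
  · exact absurd (Multiplicative.toAdd.injective h1) hx

theorem kernel_step {p q : ℕ} (hp : p.Prime) (hq : Nat.Coprime p q) {A : Type} [Group A]
    (χ : A →* Multiplicative (ZMod p)) (g : A) (hg : CP g) (e : ℤ) :
    ∃ (k n e' : ℤ) (hk : g ^ k ∈ χ.ker), k ≠ 0 ∧ CP (⟨g ^ k, hk⟩ : χ.ker) ∧ e = q * n + k * e' ∧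
      (g ∈ χ.ker → k = 1) := by
  by_cases h : g ∈ χ.ker
  · refine ⟨1, 0, e, by simpa using h, one_ne_zero, ?_, by ring, fun _ => rfl⟩
    apply CP.of_injective χ.ker.subtype Subtype.val_injective
    simpa using hg
  · obtain ⟨a, b, hab⟩ := (Nat.isCoprime_iff_coprime.2 hq)
    have hk : g ^ (p : ℤ) ∈ χ.ker := by
      rw [MonoidHom.mem_ker, map_zpow, zpow_natCast, pow_p_eq_one]
    have hp0 : (p : ℤ) ≠ 0 := by exact_mod_cast hp.ne_zero
    refine ⟨p, b * e, a * e, hk, hp0, ⟨?_, ?_⟩, ?_, fun hh => absurd hh h⟩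
    · intro m hm hh
      have := congrArg Subtype.val hh
      simp only [SubgroupClass.coe_zpow, OneMemClass.coe_one, ← zpow_mul] at this
      exact hg.1 _ (mul_ne_zero hp0 hm) this
    · intro y m hm hy
      have := congrArg Subtype.val hy
      simp only [SubgroupClass.coe_zpow, Subgroup.coe_mul, ← zpow_mul] at this
      obtain ⟨j, hj⟩ := hg.2 y _ (mul_ne_zero hp0 hm) this
      simp only at hj
      have hy1 : χ g ^ j = 1 := by rw [← map_zpow, hj]; exact y.2
      obtain ⟨i, rfl⟩ := dvd_of_zpow hp (fun hh => h hh) hy1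
      refine ⟨i, Subtype.ext ?_⟩
      simp only [SubgroupClass.coe_zpow, ← zpow_mul]
      exact hj
    · linear_combination (-e) * hab

theorem rt_split {p q : ℕ} (hp : p.Prime) (hq : Nat.Coprime p q) {P : Type} [Group P]
    (hP : FinP p P) (x : P) (n k e' : ℤ) :
    rt q x ^ ((q : ℤ) * n + k * e') = rt q (x ^ k) ^ e' * x ^ n := by
  rw [add_comm, zpow_add, zpow_mul, zpow_mul, rt_zpow, zpow_natCast, rt_pow (hP.coprime hp hq)]

theorem transform {p q : ℕ} (hp : p.Prime) (hq : Nat.Coprime p q) {A : Type} [Group A]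
    (χ : A →* Multiplicative (ZMod p)) (n : ℕ) : ∀ L : List (A × ℤ), L.length = n → OK q L →
    ∀ a : A, ∃ (L' : List (χ.ker × ℤ)) (a' : A), L'.length = n ∧ OK q L' ∧
      (∀ (P : Type) [Group P] (φ : A →* P), FinP p P →
        ev q φ L a = ev q φ (L'.map fun s => ((s.1 : A), s.2)) a') ∧
      (∀ s ∈ L.head?, ∃ t ∈ L'.head?, ∃ k : ℤ, k ≠ 0 ∧ (t.1 : A) = s.1 ^ k ∧
        (s.1 ∈ χ.ker → k = 1)) := by
  induction n with
  | zero =>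
    intro L hL _ a
    rw [List.length_eq_zero_iff] at hL
    subst hL
    exact ⟨[], a, rfl, OK.nil q, fun P _ φ _ => by simp, by simp⟩
  | succ n ih =>
    intro L hL hOK a
    rcases L with _ | ⟨⟨g, e⟩, L1⟩
    · simp at hL
    have hL1 : L1.length = n := by simpa using hL
    obtain ⟨hg, he, hhead, hOK1⟩ := OK_cons.1 hOK
    obtain ⟨k, m, e', hk, hk0, hcp, hee, hk1⟩ := kernel_step hp hq χ g hg e
    have hOK2 := hOK.cj (g ^ m)
    have hgg : g ^ m * g * (g ^ m)⁻¹ = g := by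
      rw [← zpow_add_one, ← zpow_neg, ← zpow_add]; simp
    rw [cj_cons, hgg] at hOK2
    obtain ⟨-, -, hhead2, hOK3⟩ := OK_cons.1 hOK2
    obtain ⟨L', a', h1, h2, h3, h4⟩ := ih (cj (g ^ m) L1) (by simpa using hL1) hOK3 (g ^ m * a)
    refine ⟨(⟨g ^ k, hk⟩, e') :: L', a', by simp [h1], ?_, ?_, ?_⟩
    · rw [OK_cons]
      refine ⟨hcp, ?_, ?_, h2⟩
      · intro hd
        apply he
        simp only
        rw [hee]
        exact dvd_add (dvd_mul_right _ _) (Dvd.dvd.mul_left hd _)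
      · intro t ht
        rcases hc : cj (g ^ m) L1 with _ | ⟨s, L2⟩
        · have : n = 0 := by rw [← hL1, ← cj_length (g ^ m), hc]; rfl
          rw [this, List.length_eq_zero_iff] at h1
          simp [h1] at ht
        · rw [hc] at h4 hhead2 hOK3
          obtain ⟨t', ht', k', hk', htt, -⟩ := h4 s (by simp)
          have : t = t' := by
            rw [Option.mem_def] at ht ht'
            rw [ht] at ht'
            exact Option.some.inj ht'
          subst this
          have hrel := hhead2 s (by simp)
          have hs := (OK_cons.1 hOK3).1
          refine ⟨fun hh => ?_, fun hh => ?_⟩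
          · have := congrArg Subtype.val hh
            simp only [htt] at this
            rcases hg.eq_or hs hk0 this with h | h
            · exact hrel.1 h
            · exact hrel.2 h
          · have := congrArg Subtype.val hh
            simp only [Subgroup.coe_inv, htt, ← zpow_neg] at this
            rcases hg.eq_or hs hk0 this with h | h
            · exact hrel.1 h
            · exact hrel.2 h
    · intro P _ φ hP
      rw [List.map_cons, ev_cons, ev_cons, ← h3 P φ hP, ev_cj]
      simp only
      rw [hee, rt_split hp hq hP, map_zpow, map_zpow, mul_assoc]
    · intro s hs
      simp only [List.head?_cons, Option.mem_def, Option.some.injEq] at hs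
      subst hs
      exact ⟨(⟨g ^ k, hk⟩, e'), by simp, k, hk0, rfl, hk1⟩

/-- exponent sum -/
noncomputable def es (p : ℕ) {X : Type} (x : X) : FreeGroup X →* Multiplicative (ZMod p) :=
  letI := Classical.decEq X
  FreeGroup.lift (fun y => Multiplicative.ofAdd (if y = x then 1 else 0))

theorem es_self (p : ℕ) {X : Type} (x : X) : es p x (FreeGroup.of x) = Multiplicative.ofAdd 1 := by
  simp [es]

theorem es_ne (p : ℕ) {X : Type} {x y : X} (h : y ≠ x) : es p x (FreeGroup.of y) = 1 := by
  simp [es, h]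

theorem choose_chi {p : ℕ} (hp : p.Prime) {X : Type} (h : FreeGroup X) {x x' : X} (hx : x ≠ x') :
    ∃ (χ : FreeGroup X →* Multiplicative (ZMod p)) (x0 : X), (x0 = x ∨ x0 = x') ∧
      χ (FreeGroup.of x0) = Multiplicative.ofAdd 1 ∧ χ h = 1 := by
  have : Fact p.Prime := ⟨hp⟩
  by_cases h2 : es p x' h = 1
  · exact ⟨es p x', x', Or.inr rfl, es_self p x', h2⟩
  · set a : ZMod p := (es p x h).toAdd with ha
    set b : ZMod p := (es p x' h).toAdd with hb
    have hb0 : b ≠ 0 := fun hh => h2 (Multiplicative.toAdd.injective hh)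
    refine ⟨es p x * (es p x') ^ (-(a / b)).val, x, Or.inl rfl, ?_, ?_⟩
    · rw [MonoidHom.mul_apply, MonoidHom.pow_apply, es_self, es_ne p hx, one_pow, mul_one]
    · rw [MonoidHom.mul_apply, MonoidHom.pow_apply]
      apply Multiplicative.toAdd.injective
      rw [toAdd_mul, toAdd_pow, ← ha, ← hb, nsmul_eq_mul, toAdd_one, ZMod.natCast_zmod_val]
      field_simp
      ring

theorem mem_zpowers_of_letters {X : Type} (x : X) (l : List (X × Bool)) (h : ∀ s ∈ l, s.1 = x) :
    FreeGroup.mk l ∈ Subgroup.zpowers (FreeGroup.of x) := by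
  induction l with
  | nil => exact one_mem _
  | cons s l ih =>
    have e : FreeGroup.mk (s :: l) = FreeGroup.mk [s] * FreeGroup.mk l := by simp
    rw [e]
    refine mul_mem ?_ (ih fun t ht => h t (List.mem_cons_of_mem _ ht))
    obtain ⟨y, b⟩ := s
    have := h (y, b) List.mem_cons_self
    simp only at this
    subst this
    cases b with
    | true => exact Subgroup.mem_zpowers _
    | false => exact inv_mem (Subgroup.mem_zpowers (FreeGroup.of y))

/-- dichotomy for words -/
theorem letters_cases {X : Type} [DecidableEq X] (h : FreeGroup X) (hh : h ≠ 1) :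
    (∃ x b x' b', x ≠ x' ∧ (x, b) ∈ h.toWord ∧ (x', b') ∈ h.toWord) ∨
      ∃ (x : X) (n : ℤ), n ≠ 0 ∧ h = FreeGroup.of x ^ n := by
  rcases hw : h.toWord with _ | ⟨⟨x, b⟩, tl⟩
  · exact absurd (FreeGroup.toWord_eq_nil_iff.1 hw) hh
  by_cases hall : ∀ s ∈ h.toWord, s.1 = x
  · right
    obtain ⟨n, hn⟩ := mem_zpowers_of_letters x h.toWord hall
    simp only [FreeGroup.mk_toWord] at hn
    refine ⟨x, n, ?_, hn.symm⟩
    rintro rfl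
    exact hh (by simpa using hn.symm)
  · left
    push Not at hall
    obtain ⟨⟨x', b'⟩, h1, h2⟩ := hall
    rw [hw] at h1
    exact ⟨x, b, x', b', fun hc => h2 hc.symm, List.mem_cons_self, h1⟩

end Azarov

namespace Azarov

section NF
variable {H B D : Type} [Group H] [Group B] [Group D]

/-- amalgam normal form product -/
def NF (f1 : H →* D) (f2 : B →* D) (K : List (H × B)) : D :=
  (K.map fun s => f1 s.1 * f2 s.2 * (f1 s.1)⁻¹).prod

@[simp] theorem NF_nil (f1 : H →* D) (f2 : B →* D) : NF f1 f2 [] = 1 := rfl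
@[simp] theorem NF_cons (f1 : H →* D) (f2 : B →* D) (s : H × B) (K : List (H × B)) :
    NF f1 f2 (s :: K) = f1 s.1 * f2 s.2 * (f1 s.1)⁻¹ * NF f1 f2 K := by simp [NF]

theorem map_NF {E : Type} [Group E] (f1 : H →* D) (f2 : B →* D) (F : D →* E) (K : List (H × B)) :
    F (NF f1 f2 K) = NF (F.comp f1) (F.comp f2) K := by
  induction K with
  | nil => simp
  | cons s K ih => simp [ih]

/-- reducedness of normal forms -/
def Good (C : Subgroup H) (C' : Subgroup B) (K : List (H × B)) : Prop :=
  (∀ s ∈ K, s.2 ∉ C') ∧ K.IsChain (fun s t => s.1⁻¹ * t.1 ∉ C)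

theorem Good_cons {C : Subgroup H} {C' : Subgroup B} {s : H × B} {K : List (H × B)} :
    Good C C' (s :: K) ↔ s.2 ∉ C' ∧ (∀ t ∈ K.head?, s.1⁻¹ * t.1 ∉ C) ∧ Good C C' K := by
  simp only [Good, List.isChain_cons, List.forall_mem_cons]
  tauto

theorem Good.nil (C : Subgroup H) (C' : Subgroup B) : Good C C' [] := by simp [Good]

theorem Good.map {H' B' : Type} [Group H'] [Group B'] {C : Subgroup H} {C' : Subgroup B}
    {E : Subgroup H'} {E' : Subgroup B'} {K : List (H × B)} (h : Good C C' K)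
    (f : H →* H') (g : B →* B') (hf : ∀ k, f k ∈ E → k ∈ C) (hg : ∀ s ∈ K, g s.2 ∈ E' → s.2 ∈ C') :
    Good E E' (K.map fun s => (f s.1, g s.2)) := by
  refine ⟨?_, ?_⟩
  · intro s hs
    obtain ⟨t, ht, rfl⟩ := List.mem_map.1 hs
    exact fun hh => h.1 t ht (hg t ht hh)
  · refine List.isChain_map_of_isChain _ ?_ h.2
    intro s t hst hh
    exact hst (hf _ (by simpa using hh))

variable (f1 : H →* D) (f2 : B →* D) (C : Subgroup H) (C' : Subgroup B)

/-- has a normal form -/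
def HasNF (y : D) : Prop := ∃ K a, Good C C' K ∧ y = NF f1 f2 K * f1 a

theorem HasNF.mul1 {y : D} (hy : HasNF f1 f2 C C' y) (h : H) : HasNF f1 f2 C C' (f1 h * y) := by
  obtain ⟨K, a, hK, rfl⟩ := hy
  refine ⟨K.map fun s => (h * s.1, s.2), h * a, ?_, ?_⟩
  · refine ⟨?_, List.isChain_map_of_isChain _ ?_ hK.2⟩
    · intro s hs
      obtain ⟨t, ht, rfl⟩ := List.mem_map.1 hs
      exact hK.1 t ht
    · intro s t hst
      simpa [mul_assoc] using hst
  · clear hK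
    induction K with
    | nil => simp
    | cons s K ih =>
      simp only [List.map_cons, NF_cons, map_mul] at ih ⊢
      simp only [mul_assoc] at ih ⊢
      rw [← ih]
      simp

theorem HasNF.mul2 (hC : ∀ c ∈ C, ∃ c' ∈ C', f1 c = f2 c')
    (hC' : ∀ c' ∈ C', ∃ c ∈ C, f1 c = f2 c') {y : D} (hy : HasNF f1 f2 C C' y) (b : B) :
    HasNF f1 f2 C C' (f2 b * y) := by
  by_cases hb : b ∈ C'
  · obtain ⟨c, -, hc⟩ := hC' b hb
    rw [← hc]
    exact hy.mul1 f1 f2 C C' c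
  obtain ⟨K, a, hK, rfl⟩ := hy
  rcases K with _ | ⟨⟨k, b1⟩, K⟩
  · exact ⟨[(1, b)], a, Good_cons.2 ⟨hb, by simp, Good.nil _ _⟩, by simp⟩
  · by_cases hk : k ∈ C
    · obtain ⟨c', -, hc'⟩ := hC k hk
      have hK' := Good_cons.1 hK
      have e : f2 b * (NF f1 f2 ((k, b1) :: K) * f1 a) =
          f2 (b * (c' * b1 * c'⁻¹)) * (NF f1 f2 K * f1 a) := by
        simp [hc', mul_assoc]
      rw [e]
      by_cases hb2 : b * (c' * b1 * c'⁻¹) ∈ C'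
      · obtain ⟨c, -, hc⟩ := hC' _ hb2
        rw [← hc]
        exact HasNF.mul1 f1 f2 C C' ⟨K, a, hK'.2.2, rfl⟩ c
      · refine ⟨(1, b * (c' * b1 * c'⁻¹)) :: K, a, Good_cons.2 ⟨hb2, ?_, hK'.2.2⟩, by simp [mul_assoc]⟩
        intro t ht hh
        apply hK'.2.1 t ht
        simp only [inv_one, one_mul] at hh
        exact mul_mem (inv_mem hk) hh
    · refine ⟨(1, b) :: (k, b1) :: K, a, Good_cons.2 ⟨hb, ?_, hK⟩, by simp [mul_assoc]⟩
      intro t ht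
      simp only [List.head?_cons, Option.mem_def, Option.some.injEq] at ht
      subst ht
      simpa using hk

theorem NF_exists (hC : ∀ c ∈ C, ∃ c' ∈ C', f1 c = f2 c')
    (hC' : ∀ c' ∈ C', ∃ c ∈ C, f1 c = f2 c')
    (hgen : Subgroup.closure (Set.range f1 ∪ Set.range f2) = ⊤) (y : D) :
    HasNF f1 f2 C C' y := by
  have hy : y ∈ Subgroup.closure (Set.range f1 ∪ Set.range f2) := by rw [hgen]; trivial
  induction hy using Subgroup.closure_induction_left with
  | one => exact ⟨[], 1, Good.nil _ _, by simp⟩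
  | mul_left x hx y _ ih =>
    rcases hx with ⟨h, rfl⟩ | ⟨b, rfl⟩
    · exact ih.mul1 f1 f2 C C' h
    · exact ih.mul2 f1 f2 C C' hC hC' b
  | inv_mul_cancel x hx y _ ih =>
    rcases hx with ⟨h, rfl⟩ | ⟨b, rfl⟩
    · rw [← map_inv]; exact ih.mul1 f1 f2 C C' _
    · rw [← map_inv]; exact ih.mul2 f1 f2 C C' hC hC' _

end NF

section Ping
variable {D : Type} [Group D] (C : Subgroup D)

/-- action on the free group on cosets -/
def pingAct : D →* MulAut (FreeGroup (D ⧸ C)) where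
  toFun d := FreeGroup.freeGroupCongr (MulAction.toPerm d)
  map_one' := by
    apply MulEquiv.ext
    intro x
    rw [MulAut.one_apply]
    have : (MulAction.toPerm (1 : D) : Equiv.Perm (D ⧸ C)) = Equiv.refl _ := by ext; simp
    rw [this, FreeGroup.freeGroupCongr_refl]; rfl
  map_mul' a b := by
    apply MulEquiv.ext
    intro x
    rw [MulAut.mul_apply]
    have : (MulAction.toPerm (a * b) : Equiv.Perm (D ⧸ C)) =
      (MulAction.toPerm b).trans (MulAction.toPerm a) := by ext; simp [mul_smul]
    rw [this, ← FreeGroup.freeGroupCongr_trans]; rfl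

theorem pingAct_mk (d : D) (l : List ((D ⧸ C) × Bool)) :
    pingAct C d (FreeGroup.mk l) = FreeGroup.mk (l.map fun s => (d • s.1, s.2)) := rfl

theorem pingAct_of (d : D) (l : D ⧸ C) :
    pingAct C d (FreeGroup.of l) = FreeGroup.of (d • l) := rfl

/-- ping group -/
abbrev FM : Type := FreeGroup (D ⧸ C) ⋊[pingAct C] D

/-- conjugator -/
def zz : FM C := SemidirectProduct.inl (FreeGroup.of ((1 : D) : D ⧸ C))

/-- conjugated copy -/
def cz : D →* FM C := (MulAut.conj (zz C)).toMonoidHom.comp SemidirectProduct.inr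

theorem cz_apply (d : D) : cz C d =
    ⟨FreeGroup.of ((1 : D) : D ⧸ C) * (FreeGroup.of ((d : D) : D ⧸ C))⁻¹, d⟩ := by
  apply SemidirectProduct.ext
  · simp [cz, zz, pingAct_of]
  · simp [cz, zz]

theorem cz_of_mem (d : D) (hd : d ∈ C) : cz C d = SemidirectProduct.inr d := by
  rw [cz_apply]
  have : ((d : D) : D ⧸ C) = ((1 : D) : D ⧸ C) := by
    rw [QuotientGroup.eq]; simpa using hd
  rw [this]
  apply SemidirectProduct.ext <;> simp

/-- ping word -/
def pw : D → List (D × D) → List ((D ⧸ C) × Bool)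
  | _, [] => []
  | g, (k, b) :: L => (((g * k : D) : D ⧸ C), true) :: (((g * k * b : D) : D ⧸ C), false) ::
      pw (g * k * b * k⁻¹) L

theorem pw_reduced (K : List (D × D)) (hK : Good C C K) : ∀ g, FreeGroup.IsReduced (pw C g K) := by
  unfold FreeGroup.IsReduced
  induction K with
  | nil => intro g; simp [pw]
  | cons s K ih =>
    obtain ⟨k, b⟩ := s
    intro g
    obtain ⟨h1, h2, h3⟩ := Good_cons.1 hK
    rw [pw, List.isChain_cons_cons]
    refine ⟨?_, ?_⟩
    · intro h
      exfalso
      simp only [QuotientGroup.eq] at h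
      apply h1
      simpa [mul_assoc] using h
    · rw [List.isChain_cons]
      refine ⟨?_, ih h3 _⟩
      rcases K with _ | ⟨⟨k2, b2⟩, K⟩
      · simp [pw]
      · intro y hy
        simp only [pw, List.head?_cons, Option.mem_def, Option.some.injEq] at hy
        subst hy
        intro h
        exfalso
        simp only [QuotientGroup.eq] at h
        apply h2 (k2, b2) (by simp)
        simpa [mul_assoc] using h

theorem NF_ping (K : List (D × D)) : ∀ g : D,
    SemidirectProduct.inr g * NF (SemidirectProduct.inr : D →* FM C) (cz C) K =
      ⟨FreeGroup.mk (pw C g K), g * NF (MonoidHom.id D) (MonoidHom.id D) K⟩ := by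
  induction K with
  | nil =>
    intro g
    apply SemidirectProduct.ext
    · simp only [NF_nil, mul_one, SemidirectProduct.left_inr]; rfl
    · simp
  | cons s K ih =>
    obtain ⟨k, b⟩ := s
    intro g
    have h := ih (g * k * b * k⁻¹)
    have e : (SemidirectProduct.inr g : FM C) * NF (SemidirectProduct.inr : D →* FM C) (cz C) ((k, b) :: K)
        = SemidirectProduct.inl (FreeGroup.mk [(((g * k : D) : D ⧸ C), true), (((g * k * b : D) : D ⧸ C), false)])
          * (SemidirectProduct.inr (g * k * b * k⁻¹) * NF (SemidirectProduct.inr : D →* FM C) (cz C) K) := by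
      rw [NF_cons]
      simp only [← mul_assoc]
      congr 1
      rw [cz_apply]
      apply SemidirectProduct.ext
      · simp only [SemidirectProduct.mul_left, SemidirectProduct.left_inr, SemidirectProduct.mul_right,
          SemidirectProduct.right_inr, SemidirectProduct.left_inl, map_one, map_mul, map_inv, one_mul,
          mul_one, pingAct_of, SemidirectProduct.inv_left, inv_one, MulAut.mul_apply]
        have e1 : g • k • (((1 : D)) : D ⧸ C) = ((g * k : D) : D ⧸ C) := by
          show ((g * (k * 1) : D) : D ⧸ C) = _
          rw [mul_one]
        have e2 : g • k • ((b : D) : D ⧸ C) = ((g * k * b : D) : D ⧸ C) := by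
          show ((g * (k * b) : D) : D ⧸ C) = _
          rw [mul_assoc]
        simp only [e1, e2]
        rfl
      · simp [mul_assoc]
    rw [e, h]
    apply SemidirectProduct.ext
    · simp [pw]
    · simp [mul_assoc]

theorem mk_ne_one_of_reduced {X : Type} {l : List (X × Bool)} (h : FreeGroup.IsReduced l) (hl : l ≠ []) :
    FreeGroup.mk l ≠ 1 := by
  classical
  intro hh
  have := congrArg FreeGroup.toWord hh
  rw [FreeGroup.toWord_mk, h.reduce_eq, FreeGroup.toWord_one] at this
  exact hl this

theorem fixed_head {k b : D} {K : List (D × D)} (hK : Good C C ((k, b) :: K)) {γ : D}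
    (h : pingAct C γ (FreeGroup.mk (pw C 1 ((k, b) :: K))) = FreeGroup.mk (pw C 1 ((k, b) :: K))) :
    k⁻¹ * γ * k ∈ C := by
  classical
  have hr := pw_reduced C _ hK 1
  rw [pingAct_mk] at h
  have hr2 : FreeGroup.IsReduced ((pw C 1 ((k, b) :: K)).map fun s => (γ • s.1, s.2)) := by
    unfold FreeGroup.IsReduced at *
    refine List.isChain_map_of_isChain _ ?_ hr
    intro s t hst hh
    exact hst (by simpa using hh)
  have := congrArg FreeGroup.toWord h
  rw [FreeGroup.toWord_mk, FreeGroup.toWord_mk, hr.reduce_eq, hr2.reduce_eq] at this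
  simp only [pw, List.map_cons, List.cons.injEq, Prod.mk.injEq, and_true, one_mul] at this
  have h1 := this.1
  have h2 : (((γ * k : D)) : D ⧸ C) = (k : D ⧸ C) := h1
  rw [eq_comm, QuotientGroup.eq] at h2
  simpa [mul_assoc] using h2

end Ping
end Azarov

namespace Azarov

theorem NF_map {H B H' B' D : Type} [Group H] [Group B] [Group H'] [Group B'] [Group D]
    (f : H' →* D) (g : B' →* D) (a : H →* H') (b : B →* B') (K : List (H × B)) :
    NF (f.comp a) (g.comp b) K = NF f g (K.map fun s => (a s.1, b s.2)) := by
  induction K with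
  | nil => simp
  | cons s K ih => simp [ih]

/-- `D` is obtained from `H` by adjoining a `q`-th root `s` of `x`. -/
structure RootExt (q : ℕ) {H D : Type} [Group H] [Group D] (κ : H →* D) (s : D) (x : H) : Prop where
  qpos : 0 < q
  inj : Function.Injective κ
  pow : s ^ q = κ x
  gen : Subgroup.closure (Set.range κ ∪ {s}) = ⊤
  univ : ∀ (E : Type) [Group E] (f : H →* E) (z : E), z ^ q = f x →
    ∃ F : D →* E, (∀ h, F (κ h) = f h) ∧ F s = z
  cpx : CP x

/-- multiples of `q` -/
abbrev Cq (q : ℕ) : Subgroup (Multiplicative ℤ) := Subgroup.zpowers (Multiplicative.ofAdd (q : ℤ))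

theorem mem_Cq {q : ℕ} {e : Multiplicative ℤ} : e ∈ Cq q ↔ (q : ℤ) ∣ e.toAdd := by
  constructor
  · rintro ⟨k, rfl⟩
    exact ⟨k, by simp [mul_comm]⟩
  · rintro ⟨k, hk⟩
    refine ⟨k, Multiplicative.toAdd.injective ?_⟩
    simp [hk, mul_comm]

namespace RootExt
variable {q : ℕ} {H D : Type} [Group H] [Group D] {κ : H →* D} {s : D} {x : H}


theorem s_inf (R : RootExt q κ s x) {n : ℤ} (h : s ^ n = 1) : n = 0 := by
  by_contra hn
  apply R.cpx.1 n hn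
  apply R.inj
  rw [map_one, map_zpow, ← R.pow, ← zpow_natCast, ← zpow_mul, mul_comm, zpow_mul, h, one_zpow]

theorem dvd_of_mem (R : RootExt q κ s x) {e : ℤ} (h : s ^ e ∈ Subgroup.zpowers (κ x)) : (q : ℤ) ∣ e := by
  obtain ⟨j, hj⟩ := h
  simp only at hj
  rw [← R.pow, ← zpow_natCast, ← zpow_mul] at hj
  have : s ^ (e - q * j) = 1 := by rw [zpow_sub, hj, mul_inv_cancel]
  exact ⟨j, by linarith [R.s_inf this]⟩

theorem hasNF (R : RootExt q κ s x) (y : D) :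
    HasNF κ (zpowersHom D s) (Subgroup.zpowers x) (Cq q) y := by
  apply NF_exists
  · rintro c ⟨j, rfl⟩
    refine ⟨Multiplicative.ofAdd (q : ℤ) ^ j, ⟨j, rfl⟩, ?_⟩
    simp only [zpowersHom_apply, map_zpow, ← R.pow, toAdd_zpow, toAdd_ofAdd, smul_eq_mul]
    rw [← zpow_natCast, ← zpow_mul]
  · rintro c ⟨j, rfl⟩
    refine ⟨x ^ j, ⟨j, rfl⟩, ?_⟩
    simp only [zpowersHom_apply, map_zpow, ← R.pow, toAdd_zpow, toAdd_ofAdd, smul_eq_mul]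
    rw [← zpow_natCast, ← zpow_mul]
  · rw [eq_top_iff, ← R.gen]
    apply Subgroup.closure_mono
    apply Set.union_subset_union_right
    rintro _ rfl
    exact ⟨Multiplicative.ofAdd 1, by simp [zpowersHom_apply]⟩

theorem goodD (R : RootExt q κ s x) {K : List (H × Multiplicative ℤ)} (hK : Good (Subgroup.zpowers x) (Cq q) K) :
    Good (Subgroup.zpowers (κ x)) (Subgroup.zpowers (κ x))
      (K.map fun t => (κ t.1, zpowersHom D s t.2)) := by
  apply hK.map
  · rintro k ⟨j, hj⟩
    exact ⟨j, R.inj (by simpa using hj)⟩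
  · intro t _ ht
    rw [mem_Cq]
    exact R.dvd_of_mem (by simpa [zpowersHom_apply] using ht)

theorem exists_eta (R : RootExt q κ s x) : ∃ η : D →* FM (Subgroup.zpowers (κ x)),
    ∀ (K : List (H × Multiplicative ℤ)) (a : H), η (NF κ (zpowersHom D s) K * κ a) =
      ⟨FreeGroup.mk (pw (Subgroup.zpowers (κ x)) 1 (K.map fun t => (κ t.1, zpowersHom D s t.2))),
        NF κ (zpowersHom D s) K * κ a⟩ := by
  obtain ⟨η, h1, h2⟩ := R.univ (FM (Subgroup.zpowers (κ x))) (SemidirectProduct.inr.comp κ)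
    (cz (Subgroup.zpowers (κ x)) s) (by
      rw [← map_pow, R.pow, cz_of_mem _ _ (Subgroup.mem_zpowers _)]; rfl)
  refine ⟨η, fun K a => ?_⟩
  have e1 : η.comp κ = SemidirectProduct.inr.comp κ := MonoidHom.ext h1
  have e2 : η.comp (zpowersHom D s) = (cz (Subgroup.zpowers (κ x))).comp (zpowersHom D s) := by
    refine MonoidHom.ext fun z => ?_
    rw [MonoidHom.comp_apply, MonoidHom.comp_apply, zpowersHom_apply, map_zpow, map_zpow, h2]
  rw [map_mul, map_NF, e1, e2, NF_map, ← one_mul (NF _ _ _),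
    ← map_one (SemidirectProduct.inr : D →* FM (Subgroup.zpowers (κ x))), NF_ping, h1]
  apply SemidirectProduct.ext
  · simp
  · simp only [one_mul, MonoidHom.comp_apply, SemidirectProduct.mul_right,
      SemidirectProduct.right_inr]
    rw [← NF_map]; rfl

theorem comm (R : RootExt q κ s x) {k : H} {e : Multiplicative ℤ} {K : List (H × Multiplicative ℤ)}
    (hK : Good (Subgroup.zpowers x) (Cq q) ((k, e) :: K)) {a γ γ' : H}
    (h : NF κ (zpowersHom D s) ((k, e) :: K) * κ a * κ γ =
      κ γ' * (NF κ (zpowersHom D s) ((k, e) :: K) * κ a)) :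
    k⁻¹ * γ' * k ∈ Subgroup.zpowers x := by
  obtain ⟨η, hη⟩ := R.exists_eta
  have h1 : ∀ g, η (κ g) = SemidirectProduct.inr (κ g) := by
    intro g
    have := hη [] g
    simp only [NF_nil, one_mul] at this
    rw [this]; rfl
  have h2 := congrArg η h
  rw [map_mul η _ (κ γ), map_mul η (κ γ') _, hη, h1, h1] at h2
  replace h2 := congrArg SemidirectProduct.left h2
  simp only [SemidirectProduct.mul_left, SemidirectProduct.left_inr, SemidirectProduct.right_inr,
    map_one, mul_one, one_mul, List.map_cons] at h2
  have h3 := fixed_head _ (R.goodD hK) h2.symm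
  obtain ⟨j, hj⟩ := h3
  exact ⟨j, R.inj (by simpa using hj)⟩

theorem ne_one (R : RootExt q κ s x) {K : List (H × Multiplicative ℤ)} (hne : K ≠ [])
    (hK : Good (Subgroup.zpowers x) (Cq q) K) (a : H) :
    NF κ (zpowersHom D s) K * κ a ≠ 1 := by
  obtain ⟨η, hη⟩ := R.exists_eta
  intro h
  have h2 := congrArg (fun t => (η t).left) h
  simp only [hη] at h2
  refine mk_ne_one_of_reduced (pw_reduced _ _ (R.goodD hK) 1) ?_ (by simpa using h2)
  rcases K with _ | ⟨t, K⟩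
  · exact absurd rfl hne
  · simp [pw]

theorem conj_of_mem (R : RootExt q κ s x) {g k : H} (hg : CP g) {m : ℤ} (hm : m ≠ 0)
    (h : k⁻¹ * g ^ m * k ∈ Subgroup.zpowers x) : g = k * x * k⁻¹ ∨ g = k * x⁻¹ * k⁻¹ := by
  obtain ⟨j, hj⟩ := h
  simp only at hj
  have h1 : (k⁻¹ * g * k) ^ m = x ^ j := by
    rw [hj]
    have := conj_zpow (i := m) (a := k⁻¹) (b := g)
    simpa using this
  have hc : CP (k⁻¹ * g * k) := by simpa using hg.conj k⁻¹
  rcases hc.eq_or R.cpx hm h1 with h | h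
  · left; rw [← h]; group
  · right; rw [← h]; group

theorem map_CP (R : RootExt q κ s x) {g : H} (hg : CP g) (hn : ∀ k, g ≠ k * x * k⁻¹ ∧ g ≠ k * x⁻¹ * k⁻¹) :
    CP (κ g) := by
  refine ⟨fun m hm h => hg.1 m hm (R.inj (by rw [map_zpow, h, map_one])), fun y m hm h => ?_⟩
  obtain ⟨K, a, hK, rfl⟩ := R.hasNF y
  rcases K with _ | ⟨⟨k, e⟩, K⟩
  · simp only [NF_nil, one_mul] at h ⊢
    obtain ⟨j, hj⟩ := hg.2 a m hm (R.inj (by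
      have : κ a * κ g ^ m = κ g ^ m * κ a := h
      simpa using this))
    exact ⟨j, by simp only at hj; rw [← hj]; simp⟩
  · exfalso
    have h1 : k⁻¹ * g ^ m * k ∈ Subgroup.zpowers x := by
      apply R.comm (a := a) (γ := g ^ m) hK
      rw [map_zpow]; exact h
    rcases R.conj_of_mem hg hm h1 with h | h
    · exact (hn k).1 h
    · exact (hn k).2 h

theorem centralizer (R : RootExt q κ s x) [IsMulTorsionFree H] (K : List (H × Multiplicative ℤ)) (a : H)
    (hK : Good (Subgroup.zpowers x) (Cq q) K)
    (h : Commute (NF κ (zpowersHom D s) K * κ a) (κ x)) :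
    NF κ (zpowersHom D s) K * κ a ∈ Subgroup.zpowers s := by
  induction K with
  | nil =>
    simp only [NF_nil, one_mul] at h ⊢
    obtain ⟨j, hj⟩ := R.cpx.2 a 1 one_ne_zero (R.inj (by
      have : κ a * κ x = κ x * κ a := h
      simpa using this))
    simp only at hj
    refine ⟨q * j, ?_⟩
    simp only
    rw [zpow_mul, zpow_natCast, R.pow, ← map_zpow, hj]
  | cons t K ih =>
    obtain ⟨k, e⟩ := t
    have h1 : k⁻¹ * x ^ (1 : ℤ) * k ∈ Subgroup.zpowers x := by
      rw [zpow_one]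
      exact R.comm (a := a) (γ := x) hK h
    have hk : k ∈ Subgroup.zpowers x := by
      apply R.cpx.mem_of_conj (m := 1) one_ne_zero
      simp only [zpow_neg, zpow_one]
      rcases R.conj_of_mem R.cpx one_ne_zero h1 with h | h
      · exact Or.inl h.symm
      · right
        have := congrArg (·⁻¹) h
        simpa [mul_assoc] using this.symm
    obtain ⟨j, rfl⟩ := hk
    have e1 : κ (x ^ j) * zpowersHom D s e * (κ (x ^ j))⁻¹ = s ^ e.toAdd := by
      rw [map_zpow, ← R.pow, zpowersHom_apply, ← zpow_natCast, ← zpow_mul, ← zpow_add, ← zpow_neg,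
        ← zpow_add]
      congr 1; ring
    simp only [NF_cons, e1, mul_assoc] at h ⊢
    refine mul_mem ⟨_, rfl⟩ (ih (Good_cons.1 hK).2.2 ?_)
    have hs : Commute (s ^ e.toAdd) (κ x) := by
      rw [← R.pow, ← zpow_natCast]
      exact (Commute.refl s).zpow_zpow _ _
    have := hs.inv_left.mul_left h
    simpa using this

theorem mem_of_commute (R : RootExt q κ s x) [IsMulTorsionFree H] {y : D} (h : Commute y s) : y ∈ Subgroup.zpowers s := by
  obtain ⟨K, a, hK, rfl⟩ := R.hasNF y
  apply R.centralizer K a hK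
  rw [← R.pow]
  exact h.pow_right q

end RootExt
end Azarov

namespace Azarov
namespace RootExt
variable {q : ℕ} {H D : Type} [Group H] [Group D] {κ : H →* D} {s : D} {x : H}


theorem absorb (R : RootExt q κ s x) {p : ℕ} (hp : p.Prime) (hq : Nat.Coprime p q) (a : H) (L : List (H × ℤ))
    (hL : OK q L) :
    ∃ (K : List (H × Multiplicative ℤ)) (L' : List (D × ℤ)) (a' : D),
      Good (Subgroup.zpowers x) (Cq q) K ∧ OK q L' ∧
      (L' = [] → a' = NF κ (zpowersHom D s) K * κ a) ∧
      (∀ t ∈ L'.head?, ∃ g, (∀ k, g ≠ k * x * k⁻¹ ∧ g ≠ k * x⁻¹ * k⁻¹) ∧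
        t.1 = NF κ (zpowersHom D s) K * κ g * (NF κ (zpowersHom D s) K)⁻¹ ∧
        (K = [] → ∃ s' ∈ L.head?, s'.1 = g)) ∧
      (∀ t ∈ K.head?, ∃ s' ∈ L.head?, s'.1 = t.1 * x * t.1⁻¹ ∨ s'.1 = t.1 * x⁻¹ * t.1⁻¹) ∧
      (∀ (P : Type) [Group P] (ψ : D →* P), FinP p P → ev q (ψ.comp κ) L a = ev q ψ L' a') ∧
      (L'.length + (if K = [] then 0 else 1) ≤ L.length) ∧
      (K = [] → L' = [] → L = []) ∧
      ((∃ s' ∈ L.head?, ∃ k, s'.1 = k * x * k⁻¹ ∨ s'.1 = k * x⁻¹ * k⁻¹) → K ≠ []) := by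
  induction L with
  | nil =>
    exact ⟨[], [], κ a, Good.nil _ _, OK.nil _, by simp, by simp, by simp, by simp, by simp, by simp,
      by simp⟩
  | cons s0 L ih =>
    obtain ⟨g, e⟩ := s0
    obtain ⟨hg, he, hrel, hOK⟩ := OK_cons.1 hL
    simp only at hg he hrel
    obtain ⟨K, L', a', h1, h2, h3, h4, h5, h6, h7, h8, -⟩ := ih hOK
    have rts : ∀ (P : Type) [Group P] (ψ : D →* P), FinP p P → rt q (ψ (κ x)) = ψ s := by
      intro P _ ψ hP
      exact rt_unique (hP.coprime hp hq) (by rw [← map_pow, R.pow])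
    by_cases hc : ∃ k, g = k * x * k⁻¹ ∨ g = k * x⁻¹ * k⁻¹
    · obtain ⟨k, hk⟩ := hc
      obtain ⟨E, hE, hev⟩ : ∃ E : ℤ, ¬ (q : ℤ) ∣ E ∧ ∀ (P : Type) [Group P] (ψ : D →* P), FinP p P →
          rt q (ψ (κ g)) ^ e = ψ (κ k * s ^ E * (κ k)⁻¹) := by
        rcases hk with hk | hk
        · refine ⟨e, he, fun P _ ψ hP => ?_⟩
          rw [hk]
          simp only [map_mul, map_inv, map_zpow, rt_conj, conj_zpow, rts P ψ hP]
        · refine ⟨-e, by simpa using he, fun P _ ψ hP => ?_⟩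
          rw [hk]
          simp only [map_mul, map_inv, map_zpow, rt_conj, conj_zpow, rt_inv, rts P ψ hP, zpow_neg,
            inv_zpow]
      refine ⟨(k, Multiplicative.ofAdd E) :: K, cj (κ k * s ^ E * (κ k)⁻¹) L',
        κ k * s ^ E * (κ k)⁻¹ * a', Good_cons.2 ⟨?_, ?_, h1⟩, h2.cj _, ?_, ?_, ?_, ?_, ?_, ?_, ?_⟩
      · rw [mem_Cq]; exact hE
      · intro t ht hm
        obtain ⟨s', hs', hs2⟩ := h5 t ht
        obtain ⟨j, hj⟩ := hm
        have ht1 : t.1 = k * x ^ j := by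
          simp only at hj; rw [hj]; group
        have hr := hrel s' hs'
        have c1 : k * x ^ j * x * (k * x ^ j)⁻¹ = k * x * k⁻¹ := by group
        have c2 : k * x ^ j * x⁻¹ * (k * x ^ j)⁻¹ = k * x⁻¹ * k⁻¹ := by group
        rw [ht1, c1, c2] at hs2
        rcases hs2 with hs2 | hs2 <;> rcases hk with hk | hk
        · exact hr.1 (by rw [hs2]; exact hk)
        · exact hr.2 (by rw [hs2]; simp [hk, mul_assoc])
        · exact hr.2 (by rw [hs2]; simp [hk, mul_assoc])
        · exact hr.1 (by rw [hs2]; exact hk)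
      · intro hn
        have : L' = [] := by simpa [cj] using hn
        rw [h3 this, NF_cons]
        simp [zpowersHom_apply, mul_assoc]
      · intro t ht
        rcases L' with _ | ⟨t0, L'⟩
        · simp at ht
        · simp only [cj_cons, List.head?_cons, Option.mem_def, Option.some.injEq] at ht
          obtain ⟨g2, hg2, ht2, -⟩ := h4 t0 (by simp)
          refine ⟨g2, hg2, ?_, by simp⟩
          rw [← ht, ht2, NF_cons]
          simp [zpowersHom_apply, mul_assoc]
      · intro t ht
        simp only [List.head?_cons, Option.mem_def, Option.some.injEq] at ht
        subst ht
        exact ⟨(g, e), by simp, hk⟩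
      · intro P _ ψ hP
        rw [ev_cj, ev_cons, h6 P ψ hP, MonoidHom.comp_apply, hev P ψ hP]
      · simp only [cj_length, List.length_cons, List.cons_ne_nil, if_false]
        split_ifs at h7 <;> omega
      · simp
      · simp
    · simp only [not_exists, not_or] at hc
      refine ⟨[], (κ g, e) :: L', a', Good.nil _ _, OK_cons.2 ⟨R.map_CP hg hc, he, ?_, h2⟩, by simp, ?_,
        by simp, ?_, ?_, by simp, ?_⟩
      · intro t ht
        obtain ⟨g2, hg2, ht2, hK2⟩ := h4 t ht
        have key : ∀ γ : H, γ = g2 ∨ γ = g2⁻¹ →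
            κ g ≠ NF κ (zpowersHom D s) K * κ γ * (NF κ (zpowersHom D s) K)⁻¹ := by
          intro γ hγ hh
          rcases K with _ | ⟨⟨k, e1⟩, K⟩
          · obtain ⟨s', hs', hs2⟩ := hK2 rfl
            have hr := hrel s' hs'
            have : g = γ := R.inj (by simpa using hh)
            rw [← hs2] at hγ
            rcases hγ with hγ | hγ
            · exact hr.1 (this.trans hγ)
            · exact hr.2 (this.trans hγ)
          · have hm := R.comm (a := 1) (γ := γ) (γ' := g) h1 (by
              rw [hh, map_one, mul_one, inv_mul_cancel_right])
            rcases R.conj_of_mem hg (m := 1) (k := k) one_ne_zero (by simpa using hm) with h | h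
            · exact (hc k).1 h
            · exact (hc k).2 h
        refine ⟨?_, ?_⟩
        · rw [ht2]; exact key g2 (Or.inl rfl)
        · rw [ht2]
          have := key g2⁻¹ (Or.inr rfl)
          simpa [mul_assoc] using this
      · intro t ht
        simp only [List.head?_cons, Option.mem_def, Option.some.injEq] at ht
        subst ht
        exact ⟨g, hc, by simp, fun _ => ⟨(g, e), by simp, rfl⟩⟩
      · intro P _ ψ hP
        rw [ev_cons, ev_cons, h6 P ψ hP]; rfl
      · simp only [List.length_cons, if_true]
        split_ifs at h7 <;> omega
      · rintro ⟨s', hs', k, hk⟩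
        simp only [List.head?_cons, Option.mem_def, Option.some.injEq] at hs'
        subst hs'
        rcases hk with hk | hk
        · exact absurd hk (hc k).1
        · exact absurd hk (hc k).2

theorem absorb' (R : RootExt q κ s x) {p : ℕ} (hp : p.Prime) (hq : Nat.Coprime p q) (a : H) (L : List (H × ℤ))
    (hL : OK q L) (hne : L ≠ [] ∨ a ≠ 1) :
    ∃ (L' : List (D × ℤ)) (a' : D), OK q L' ∧ (L' ≠ [] ∨ a' ≠ 1) ∧
      (∀ (P : Type) [Group P] (ψ : D →* P), FinP p P → ev q (ψ.comp κ) L a = ev q ψ L' a') ∧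
      ((∃ s' ∈ L.head?, ∃ k, s'.1 = k * x * k⁻¹ ∨ s'.1 = k * x⁻¹ * k⁻¹) →
        L'.length < L.length) := by
  obtain ⟨K, L', a', h1, h2, h3, -, -, h6, h7, h8, h9⟩ := R.absorb hp hq a L hL
  refine ⟨L', a', h2, ?_, h6, fun h => ?_⟩
  · by_cases hL' : L' = []
    · right
      rw [h3 hL']
      by_cases hK : K = []
      · have := h8 hK hL'
        rcases hne with hne | hne
        · exact absurd this hne
        · subst hK
          intro hh
          exact hne (R.inj (by simpa using hh))
      · exact R.ne_one hK h1 a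
    · exact Or.inl hL'
  · have := h9 h
    simp only [this, if_false] at h7
    omega

end RootExt
end Azarov

namespace Azarov

/-- word length with classical decidability -/
noncomputable def nrm {X : Type} (w : FreeGroup X) : ℕ := letI := Classical.decEq X; w.norm

/-- first entry -/
def hd {A : Type} (L : List (A × ℤ)) (a : A) : A :=
  match L with
  | [] => a
  | s :: _ => s.1

theorem hd_ne_one {A : Type} [Group A] {q : ℕ} {L : List (A × ℤ)} {a : A} (hL : OK q L)
    (h : L ≠ [] ∨ a ≠ 1) : hd L a ≠ 1 := by
  rcases L with _ | ⟨s, L⟩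
  · simpa [hd] using h
  · intro hh
    exact (OK_cons.1 hL).1.1 1 one_ne_zero (by simpa [hd] using hh)

theorem ev_ker {p q : ℕ} {A : Type} [Group A] (χ : A →* Multiplicative (ZMod p))
    (L : List (χ.ker × ℤ)) (a : A) : ev q χ (L.map fun s => ((s.1 : A), s.2)) a = χ a := by
  induction L with
  | nil => simp
  | cons s L ih =>
    have : χ s.1 = 1 := s.1.2
    simp [ih, this, rt]

theorem caseA {p q : ℕ} (hp : p.Prime) (hq : Nat.Coprime p q) {X : Type} (n : ℕ)
    (L : List (FreeGroup X × ℤ)) (a : FreeGroup X) (hn : L.length = n) (hL : OK q L)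
    (hlet : letI := Classical.decEq X;
      ∃ x b x' b', x ≠ x' ∧ (x, b) ∈ (hd L a).toWord ∧ (x', b') ∈ (hd L a).toWord)
    (ha : hd L a ≠ 1)
    (IH : ∀ (Y : Type) (L' : List (FreeGroup Y × ℤ)) (a' : FreeGroup Y), L'.length = n → OK q L' →
      hd L' a' ≠ 1 → nrm (hd L' a') < nrm (hd L a) → Det p q L' a') : Det p q L a := by
  obtain ⟨x, b, x', b', hx, h1, h2⟩ := hlet
  obtain ⟨χ, x0, hx0, h0, hk⟩ := choose_chi hp (hd L a) hx
  have hb : ∃ b, letI := Classical.decEq X; (x0, b) ∈ (hd L a).toWord := by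
    rcases hx0 with rfl | rfl
    · exact ⟨b, h1⟩
    · exact ⟨b', h2⟩
  obtain ⟨b0, hb0⟩ := hb
  obtain ⟨Y, c, j, hj, hjc, hnorm, hdet⟩ := schreier χ x0 hp h0 (hd L a) hk
  have hlt := hnorm b0 hb0
  rcases L with _ | ⟨s, L⟩
  · have := hdet q hq [] ⟨a, hk⟩ (IH Y [] _ hn (OK.nil q) (by
      intro hh
      apply ha
      have := congrArg j hh
      simp only [hd, hjc, map_one] at this
      exact congrArg Subtype.val this) hlt)
    simpa using this
  · obtain ⟨L', a', e1, e2, e3, e4⟩ := transform hp hq χ n (s :: L) hn hL a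
    obtain ⟨t, ht, k, -, htk, hk1⟩ := e4 s (by simp)
    rcases L' with _ | ⟨t', L'⟩
    · simp at ht
    simp only [List.head?_cons, Option.mem_def, Option.some.injEq] at ht
    subst ht
    have hkk := hk1 hk
    rw [hkk, zpow_one] at htk
    by_cases ha' : χ a' = 1
    · have hOK' := e2.map c j hj hjc
      have ht' : t'.1 = ⟨s.1, hk⟩ := Subtype.ext htk
      obtain ⟨P, _, φ, hP, hev⟩ := hdet q hq (t' :: L') ⟨a', ha'⟩ (IH Y _ _ (by simpa using e1) hOK'
        (hd_ne_one hOK' (by simp)) (by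
          simp only [List.map_cons, hd, ht']
          exact hlt))
      exact ⟨P, _, φ, hP, by rw [e3 P φ hP]; exact hev⟩
    · exact ⟨_, _, χ, finP_zmod1 hp, by rw [e3 _ χ (finP_zmod1 hp), ev_ker]; exact ha'⟩

theorem rootExt_free {p q : ℕ} (hp : p.Prime) (hq : Nat.Coprime p q) (hq0 : 0 < q) {X : Type} (x : X)
    (res : ∀ a : FreeGroup X, a ≠ 1 → Det p q [] a) :
    ∃ κ : FreeGroup X →* FreeGroup X, RootExt q κ (FreeGroup.of x) (FreeGroup.of x) := by
  classical
  let κ : FreeGroup X →* FreeGroup X :=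
    FreeGroup.lift (Function.update FreeGroup.of x (FreeGroup.of x ^ q))
  have univ : ∀ (E : Type) [Group E] (f : FreeGroup X →* E) (z : E), z ^ q = f (FreeGroup.of x) →
    ∃ F : FreeGroup X →* E, (∀ h, F (κ h) = f h) ∧ F (FreeGroup.of x) = z := by
    intro E _ f z hz
    refine ⟨FreeGroup.lift (Function.update (fun y => f (FreeGroup.of y)) x z), ?_, by simp⟩
    intro h
    have : (FreeGroup.lift (Function.update (fun y => f (FreeGroup.of y)) x z)).comp κ = f := by
      ext y
      by_cases hy : y = x
      · subst hy; simp [κ, hz]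
      · simp [κ, hy]
    exact DFunLike.congr_fun this h
  refine ⟨κ, hq0, ?_, by simp [κ], ?_, univ, CP_of x⟩
  · rw [injective_iff_map_eq_one]
    intro a ha
    by_contra hne
    obtain ⟨P, _, φ, hP, hev⟩ := res a hne
    obtain ⟨F, hF, -⟩ := univ P φ (rt q (φ (FreeGroup.of x))) (rt_pow (hP.coprime hp hq) _)
    apply hev
    rw [ev_nil, ← hF, ha, map_one]
  · rw [eq_top_iff, ← FreeGroup.closure_range_of, Subgroup.closure_le]
    rintro _ ⟨y, rfl⟩
    apply Subgroup.subset_closure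
    by_cases hy : y = x
    · right; simp [hy]
    · left; exact ⟨FreeGroup.of y, by simp [κ, hy]⟩

theorem claim {p q : ℕ} (hp : p.Prime) (hq : Nat.Coprime p q) (hq0 : 0 < q) (n : ℕ) :
    ∀ (N : ℕ) (X : Type) (L : List (FreeGroup X × ℤ)) (a : FreeGroup X), L.length = n → OK q L →
      hd L a ≠ 1 → nrm (hd L a) = N → Det p q L a := by
  induction n using Nat.strong_induction_on with
  | _ n IHn =>
  intro N
  induction N using Nat.strong_induction_on with
  | _ N IHN =>
  intro X L a hn hL ha hN
  rcases @letters_cases X (Classical.decEq X) (hd L a) ha with hlet | ⟨x, k, hk, hx⟩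
  · refine caseA hp hq n L a hn hL hlet ha ?_
    intro Y L' a' h1 h2 h3 h4
    exact IHN _ (hN ▸ h4) Y L' a' h1 h2 h3 rfl
  · rcases L with _ | ⟨s, L⟩
    · obtain ⟨N, hNk⟩ : ∃ N, k.natAbs < p ^ N := ⟨_, Nat.lt_pow_self hp.one_lt⟩
      refine ⟨_, _, es (p ^ N) x, finP_zmod hp N, ?_⟩
      rw [ev_nil]
      simp only [hd] at hx
      rw [hx, map_zpow, es_self]
      intro hh
      have := congrArg Multiplicative.toAdd hh
      simp only [toAdd_zpow, toAdd_ofAdd, toAdd_one, zsmul_eq_mul, mul_one] at this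
      rw [ZMod.intCast_zmod_eq_zero_iff_dvd] at this
      have h1 := Int.natAbs_dvd_natAbs.2 this
      rw [Int.natAbs_natCast] at h1
      have := Nat.le_of_dvd (Int.natAbs_pos.2 hk) h1
      omega
    · simp only [hd] at hx
      have hs := (OK_cons.1 hL).1
      have hn0 : 0 < n := by rw [← hn]; simp
      obtain ⟨κ, R⟩ := rootExt_free hp hq hq0 x
        (fun a ha => IHn 0 hn0 _ X [] a rfl (OK.nil q) ha rfl)
      obtain ⟨L', a', h1, h2, h3, h4⟩ := R.absorb' hp hq a (s :: L) hL (by simp)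
      have hlt := h4 ⟨s, by simp, 1, by
        rcases hs.eq_or (CP_of x) (m := 1) (n := k) one_ne_zero (by simpa using hx) with h | h
        · left; simpa using h
        · right; simpa using h⟩
      obtain ⟨P, _, ψ, hP, hev⟩ := IHn L'.length (hn ▸ hlt) _ X L' a' rfl h1 (hd_ne_one h1 h2) rfl
      exact ⟨P, _, ψ.comp κ, hP, by rw [h3 P ψ hP]; exact hev⟩

theorem claim' {p q : ℕ} (hp : p.Prime) (hq : Nat.Coprime p q) (hq0 : 0 < q) {X : Type}
    (L : List (FreeGroup X × ℤ)) (a : FreeGroup X) (hL : OK q L) (h : L ≠ [] ∨ a ≠ 1) :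
    Det p q L a :=
  claim hp hq hq0 _ _ X L a rfl hL (hd_ne_one hL h) rfl

end Azarov

namespace Azarov

/-- residually a finite `p`-group -/
def ResP (p : ℕ) (D : Type) [Group D] : Prop :=
  ∀ y : D, y ≠ 1 → ∃ (P : Type) (_ : Group P) (φ : D →* P), FinP p P ∧ φ y ≠ 1

/-- separability of the cyclic subgroup generated by `s` -/
def Sep (p : ℕ) {D : Type} [Group D] (s : D) : Prop :=
  ∀ y : D, y ∉ Subgroup.zpowers s → ∃ (P : Type) (_ : Group P) (φ : D →* P),
    FinP p P ∧ φ y ∉ Subgroup.zpowers (φ s)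

theorem resP_free {p : ℕ} (hp : p.Prime) (X : Type) : ResP p (FreeGroup X) := by
  intro y hy
  obtain ⟨P, i, φ, hP, h⟩ := claim' hp (Nat.coprime_one_right p) one_pos [] y (OK.nil 1) (Or.inr hy)
  exact ⟨P, i, φ, hP, by simpa using h⟩

theorem sep_of_comm {p : ℕ} {D : Type} [Group D] (hD : ResP p D) {s : D}
    (h : ∀ y, Commute y s → y ∈ Subgroup.zpowers s) : Sep p s := by
  intro y hy
  have hne : y * s * y⁻¹ * s⁻¹ ≠ 1 := by
    intro hh
    apply hy
    apply h
    show y * s = s * y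
    rw [mul_inv_eq_one, mul_inv_eq_iff_eq_mul] at hh
    exact hh
  obtain ⟨P, i, φ, hP, hφ⟩ := hD _ hne
  refine ⟨P, i, φ, hP, ?_⟩
  rintro ⟨k, hk⟩
  simp only at hk
  apply hφ
  simp only [map_mul, map_inv, ← hk]
  group

theorem FinP.orderOf {p : ℕ} (hp : p.Prime) {P : Type} [Group P] (hP : FinP p P) (x : P) :
    ∃ n, orderOf x = p ^ n := by
  have := Fact.mk hp
  exact IsPGroup.iff_orderOf.1 hP.2 x

theorem sep_free {p : ℕ} (hp : p.Prime) {X : Type} (w : FreeGroup X) (hw : CP w) (r : ℕ) :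
    Sep p (w ^ (p ^ r)) := by
  intro y hy
  by_cases hyw : y ∈ Subgroup.zpowers w
  · obtain ⟨j, rfl⟩ := hyw
    simp only at hy ⊢
    have hr : r ≠ 0 := by
      rintro rfl
      exact hy ⟨j, by simp⟩
    obtain ⟨r, rfl⟩ := Nat.exists_eq_succ_of_ne_zero hr
    obtain ⟨P, i, φ, hP, hφ⟩ := resP_free hp X (w ^ (p ^ r)) (by
      have := hw.1 ((p ^ r : ℕ) : ℤ) (by exact_mod_cast pow_ne_zero r hp.ne_zero)
      rwa [zpow_natCast] at this)
    refine ⟨P, i, φ, hP, ?_⟩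
    rintro ⟨k, hk⟩
    apply hy
    obtain ⟨N, hN⟩ := hP.orderOf hp (φ w)
    have hrN : r + 1 ≤ N := by
      by_contra hlt
      apply hφ
      rw [map_pow, ← orderOf_dvd_iff_pow_eq_one, hN]
      exact pow_dvd_pow p (by omega)
    have hdvd : ((p ^ (r + 1) : ℕ) : ℤ) ∣ orderOf (φ w) := by
      rw [hN]; exact_mod_cast pow_dvd_pow p hrN
    have e : φ w ^ (((p ^ (r + 1) : ℕ) : ℤ) * k - j) = 1 := by
      simp only [map_pow, map_zpow] at hk
      rw [zpow_sub, zpow_mul, zpow_natCast, hk, mul_inv_cancel]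
    have h2 := hdvd.trans (orderOf_dvd_iff_zpow_eq_one.2 e)
    have h3 : ((p ^ (r + 1) : ℕ) : ℤ) ∣ j := by
      have := (Int.dvd_mul_right ((p ^ (r + 1) : ℕ) : ℤ) k)
      exact (dvd_sub_right this).1 h2
    obtain ⟨l, rfl⟩ := h3
    exact ⟨l, by simp only; rw [zpow_mul, zpow_natCast]⟩
  · obtain ⟨P, i, φ, hP, hφ⟩ := sep_of_comm (resP_free hp X) (s := w)
      (fun y h => hw.2 y 1 one_ne_zero (by simpa using h)) y hyw
    refine ⟨P, i, φ, hP, fun h => hφ ?_⟩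
    refine (Subgroup.zpowers_le.2 ?_) h
    rw [map_pow]
    exact Subgroup.npow_mem_zpowers _ _

theorem rootExt_of {p q : ℕ} (hp : p.Prime) (hq : Nat.Coprime p q) (hq0 : 0 < q) {X : Type}
    (x : FreeGroup X) (hx : CP x) {M : Type} [Group M] (i : FreeGroup X →* M) (t : M)
    (gen : Subgroup.closure (Set.range i ∪ {t}) = ⊤)
    (lft : ∀ (E : Type) [Group E] (f : FreeGroup X →* E) (z : E),
      ∃ F : M →* E, (∀ h, F (i h) = f h) ∧ F t = z) :
    ∃ (D : Type) (_ : Group D) (κ : FreeGroup X →* D) (s : D), RootExt q κ s x := by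
  obtain ⟨N, hN⟩ : ∃ N : Subgroup M, N = Subgroup.normalClosure {t ^ q * (i x)⁻¹} := ⟨_, rfl⟩
  have hNn : N.Normal := by rw [hN]; infer_instance
  have univ : ∀ (E : Type) [Group E] (f : FreeGroup X →* E) (z : E), z ^ q = f x →
    ∃ F : M ⧸ N →* E, (∀ h, F (((QuotientGroup.mk' N).comp i) h) = f h) ∧
      F (QuotientGroup.mk' N t) = z := by
    intro E _ f z hz
    obtain ⟨F, h1, h2⟩ := lft E f z
    have hle : N ≤ F.ker := by
      rw [hN]
      apply Subgroup.normalClosure_le_normal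
      rintro _ rfl
      simp [MonoidHom.mem_ker, h1, h2, hz]
    refine ⟨QuotientGroup.lift N F (fun y hy => hle hy), ?_, ?_⟩
    · intro h; simp [h1]
    · simp [h2]
  refine ⟨M ⧸ N, inferInstance, (QuotientGroup.mk' N).comp i, QuotientGroup.mk' N t, hq0, ?_, ?_, ?_,
    univ, hx⟩
  · rw [injective_iff_map_eq_one]
    intro a ha
    by_contra hne
    obtain ⟨P, _, φ, hP, hev⟩ := resP_free hp X a hne
    obtain ⟨F, hF, -⟩ := univ P φ (rt q (φ x)) (rt_pow (hP.coprime hp hq) _)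
    apply hev
    rw [← hF, ha, map_one]
  · have : QuotientGroup.mk' N (t ^ q * (i x)⁻¹) = 1 := by
      rw [QuotientGroup.mk'_apply, QuotientGroup.eq_one_iff, hN]
      exact Subgroup.subset_normalClosure rfl
    rw [map_mul, map_inv, map_pow, mul_inv_eq_one] at this
    exact this
  · rw [eq_top_iff]
    intro y _
    obtain ⟨y, rfl⟩ := QuotientGroup.mk'_surjective N y
    have hy : y ∈ Subgroup.closure (Set.range i ∪ {t}) := by rw [gen]; trivial
    have := Subgroup.mem_map_of_mem (QuotientGroup.mk' N) hy
    rw [MonoidHom.map_closure] at this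
    refine Subgroup.closure_mono ?_ this
    rw [Set.image_union, Set.image_singleton, ← Set.range_comp]
    rfl

theorem rootExt_exists {p q : ℕ} (hp : p.Prime) (hq : Nat.Coprime p q) (hq0 : 0 < q) {X : Type}
    (x : FreeGroup X) (hx : CP x) :
    ∃ (D : Type) (_ : Group D) (κ : FreeGroup X →* D) (s : D), RootExt q κ s x := by
  refine rootExt_of hp hq hq0 x hx
    (FreeGroup.map Sum.inl : FreeGroup X →* FreeGroup (X ⊕ Unit)) (FreeGroup.of (Sum.inr ())) ?_ ?_
  · rw [eq_top_iff, ← FreeGroup.closure_range_of, Subgroup.closure_le]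
    rintro _ ⟨y | y, rfl⟩
    · exact Subgroup.subset_closure (Or.inl ⟨FreeGroup.of y, by simp⟩)
    · exact Subgroup.subset_closure (Or.inr rfl)
  · intro E _ f z
    refine ⟨FreeGroup.lift (Sum.elim (fun y => f (FreeGroup.of y)) (fun _ => z)), ?_, by simp⟩
    intro h
    have : (FreeGroup.lift (Sum.elim (fun y => f (FreeGroup.of y)) (fun _ : Unit => z))).comp
        (FreeGroup.map Sum.inl) = f := by
      ext y; simp
    exact DFunLike.congr_fun this h

theorem RootExt.resP {p q : ℕ} (hp : p.Prime) (hq : Nat.Coprime p q) {X : Type} {D : Type} [Group D]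
    {κ : FreeGroup X →* D} {s : D} {x : FreeGroup X} (R : RootExt q κ s x) : ResP p D := by
  intro y hy
  obtain ⟨K, a, hK, rfl⟩ := R.hasNF y
  have hOK : OK q (K.map fun t => (t.1 * x * t.1⁻¹, t.2.toAdd)) := by
    refine ⟨?_, ?_⟩
    · intro t ht
      obtain ⟨t', ht', rfl⟩ := List.mem_map.1 ht
      exact ⟨R.cpx.conj _, fun h => hK.1 t' ht' (mem_Cq.2 h)⟩
    · refine List.isChain_map_of_isChain _ ?_ hK.2
      intro t t' h
      refine ⟨fun hh => h ?_, fun hh => h ?_⟩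
      · rw [← inv_mem_iff]
        apply R.cpx.mem_of_conj (m := 1) one_ne_zero
        left
        simp only at hh
        have := congrArg (fun z => t'.1⁻¹ * z * t'.1) hh
        simp only [mul_assoc, inv_mul_cancel, mul_one, inv_mul_cancel_left] at this
        simpa [mul_assoc] using this
      · rw [← inv_mem_iff]
        apply R.cpx.mem_of_conj (m := 1) one_ne_zero
        right
        simp only at hh
        have := congrArg (fun z => t'.1⁻¹ * z * t'.1) hh
        simp only [mul_inv_rev, inv_inv, mul_assoc, inv_mul_cancel, mul_one, inv_mul_cancel_left] at this
        simpa [mul_assoc] using this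
  obtain ⟨P, i, φ, hP, hev⟩ := claim' hp hq R.qpos _ a hOK (by
    by_contra hh
    simp only [not_or, not_not, ne_eq, List.map_eq_nil_iff] at hh
    obtain ⟨rfl, rfl⟩ := hh
    simp at hy)
  obtain ⟨ψ, hψ, hs⟩ := R.univ P φ (rt q (φ x)) (rt_pow (hP.coprime hp hq) _)
  refine ⟨P, i, ψ, hP, ?_⟩
  have : ψ (NF κ (zpowersHom D s) K * κ a) =
      ev q φ (K.map fun t => (t.1 * x * t.1⁻¹, t.2.toAdd)) a := by
    clear hev hK hOK hy
    induction K with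
    | nil => simp [hψ]
    | cons t K ih =>
      rw [List.map_cons, ev_cons, ← ih, NF_cons, mul_assoc, map_mul]
      congr 1
      simp only [map_mul, map_inv, hψ, zpowersHom_apply, map_zpow, hs, rt_conj, conj_zpow]
  rw [this]
  exact hev

theorem RootExt.sep {p q : ℕ} (hp : p.Prime) (hq : Nat.Coprime p q) {X : Type} {D : Type} [Group D]
    {κ : FreeGroup X →* D} {s : D} {x : FreeGroup X} (R : RootExt q κ s x) : Sep p s :=
  sep_of_comm (R.resP hp hq) (fun _ h => R.mem_of_commute h)

end Azarov

namespace Azarov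

theorem central_p {p : ℕ} (hp : p.Prime) {P : Type} [Group P] (hP : FinP p P) [Nontrivial P] :
    ∃ z : P, (∀ y, Commute y z) ∧ orderOf z = p := by
  have := Fact.mk hp
  have := hP.1
  have hn := hP.2.center_nontrivial
  have hc : FinP p (Subgroup.center P) := ⟨inferInstance, hP.2.to_subgroup _⟩
  obtain ⟨n, hn'⟩ := (finP_iff hp).1 hc
  have hd : p ∣ Nat.card (Subgroup.center P) := by
    rw [hn']
    apply dvd_pow_self
    rintro rfl
    rw [pow_zero] at hn'
    have := Finite.one_lt_card (α := Subgroup.center P)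
    omega
  obtain ⟨z, hz⟩ := exists_prime_orderOf_dvd_card' p hd
  refine ⟨z, fun y => (Subgroup.mem_center_iff.1 z.2 y), ?_⟩
  rw [← hz]
  exact Subgroup.orderOf_coe z

theorem normal_of_central {P : Type} [Group P] {z : P} (hz : ∀ y, Commute y z) :
    (Subgroup.zpowers z).Normal := by
  refine ⟨fun n hn g => ?_⟩
  obtain ⟨k, rfl⟩ := hn
  have : g * z ^ k * g⁻¹ = z ^ k := by
    rw [((hz g).zpow_right k).eq, mul_inv_cancel_right]
  simp only [this]
  exact ⟨k, rfl⟩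

theorem FinP.quotient {p : ℕ} {P : Type} [Group P] (hP : FinP p P) (N : Subgroup P)
    [N.Normal] : FinP p (P ⧸ N) := by
  have := hP.1
  exact ⟨inferInstance, hP.2.to_quotient N⟩

theorem card_quotient_lt {p : ℕ} (hp : p.Prime) {P : Type} [Group P] (hP : FinP p P) {z : P}
    (hz : orderOf z = p) : Nat.card (P ⧸ Subgroup.zpowers z) < Nat.card P := by
  have := hP.1
  have h := Subgroup.card_eq_card_quotient_mul_card_subgroup (Subgroup.zpowers z)
  rw [Nat.card_zpowers, hz] at h
  rw [h]
  have : 0 < Nat.card (P ⧸ Subgroup.zpowers z) := Nat.card_pos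
  nlinarith [hp.two_le]

theorem order_drop {p : ℕ} (hp : p.Prime) (n : ℕ) : ∀ (P : Type) [Group P], FinP p P →
    Nat.card P = n → ∀ (x : P) (N j : ℕ), orderOf x = p ^ N → j ≤ N →
    ∃ (Q : Type) (_ : Group Q) (f : P →* Q), FinP p Q ∧ orderOf (f x) = p ^ j := by
  induction n using Nat.strong_induction_on with
  | _ n ih =>
  intro P _ hP hn x N j hx hj
  rcases hj.eq_or_lt with rfl | hj
  · exact ⟨P, _, MonoidHom.id P, hP, hx⟩
  have hnt : Nontrivial P := by
    refine ⟨x, 1, ?_⟩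
    rintro rfl
    rw [orderOf_one] at hx
    have : 1 < p ^ N := Nat.one_lt_pow (by omega) hp.one_lt
    omega
  obtain ⟨z, hz, hzp⟩ := central_p hp hP
  have := normal_of_central hz
  have hQ := hP.quotient (Subgroup.zpowers z)
  obtain ⟨N', hN'⟩ := hQ.orderOf hp (QuotientGroup.mk' (Subgroup.zpowers z) x)
  have hle : N ≤ N' + 1 := by
    have h1 := pow_orderOf_eq_one (QuotientGroup.mk' (Subgroup.zpowers z) x)
    rw [hN', ← map_pow, QuotientGroup.mk'_apply, QuotientGroup.eq_one_iff] at h1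
    obtain ⟨k, hk⟩ := h1
    simp only at hk
    have h2 : x ^ (p ^ (N' + 1)) = 1 := by
      rw [pow_succ, pow_mul, ← hk, ← zpow_natCast, ← zpow_mul, mul_comm, zpow_mul, zpow_natCast,
        ← hzp, pow_orderOf_eq_one, one_zpow]
    have h3 := orderOf_dvd_of_pow_eq_one h2
    rw [hx] at h3
    exact (Nat.pow_dvd_pow_iff_le_right hp.one_lt).1 h3
  obtain ⟨Q, i, f, hQ', hf⟩ := ih _ (hn ▸ card_quotient_lt hp hP hzp) _ hQ rfl _ N' j hN' (by omega)
  exact ⟨Q, i, f.comp (QuotientGroup.mk' _), hQ', hf⟩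

/-- orders realised -/
theorem ResP.exists_order {p : ℕ} (hp : p.Prime) {D : Type} [Group D] (hD : ResP p D) {s : D}
    (hs : ∀ m : ℕ, m ≠ 0 → s ^ m ≠ 1) (j : ℕ) :
    ∃ (Q : Type) (_ : Group Q) (f : D →* Q), FinP p Q ∧ orderOf (f s) = p ^ j := by
  obtain ⟨P, _, φ, hP, h⟩ := hD (s ^ p ^ j) (hs _ (pow_ne_zero _ hp.ne_zero))
  obtain ⟨N, hN⟩ := hP.orderOf hp (φ s)
  obtain ⟨Q, i, f, hQ, hf⟩ := order_drop hp _ P hP rfl (φ s) N j hN (by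
    by_contra hlt
    apply h
    rw [map_pow, ← orderOf_dvd_iff_pow_eq_one, hN]
    exact pow_dvd_pow p (by omega))
  exact ⟨Q, i, f.comp φ, hQ, hf⟩

theorem combine {p : ℕ} (hp : p.Prime) {D : Type} [Group D] {s : D} (hsep : Sep p s)
    (T : List D) (hT : ∀ t ∈ T, t ∉ Subgroup.zpowers s) :
    ∃ (Q : Type) (_ : Group Q) (f : D →* Q), FinP p Q ∧
      ∀ t ∈ T, f t ∉ Subgroup.zpowers (f s) := by
  induction T with
  | nil => exact ⟨Multiplicative (ZMod p), inferInstance, 1, finP_zmod1 hp, by simp⟩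
  | cons t T ih =>
    obtain ⟨Q, _, f, hQ, hf⟩ := ih (fun t ht => hT t (List.mem_cons_of_mem _ ht))
    obtain ⟨Q', _, f', hQ', hf'⟩ := hsep t (hT t List.mem_cons_self)
    refine ⟨Q × Q', inferInstance, f.prod f', hQ.prod hp hQ', ?_⟩
    rintro t' ht' ⟨k, hk⟩
    simp only [MonoidHom.prod_apply, Prod.pow_mk, Prod.mk.injEq] at hk
    rcases List.mem_cons.1 ht' with rfl | ht'
    · exact hf' ⟨k, hk.2⟩
    · exact hf t' ht' ⟨k, hk.1⟩

/-- enlarging the order -/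
theorem enlarge {p : ℕ} (hp : p.Prime) {D : Type} [Group D] (hD : ResP p D) {s : D}
    (hs : ∀ m : ℕ, m ≠ 0 → s ^ m ≠ 1) {Q : Type} [Group Q] (f : D →* Q) (hQ : FinP p Q) {N M : ℕ}
    (hN : orderOf (f s) = p ^ N) (hNM : N ≤ M) :
    ∃ (Q' : Type) (_ : Group Q') (f' : D →* Q'), FinP p Q' ∧ orderOf (f' s) = p ^ M ∧
      (∀ t, f' t ∈ Subgroup.zpowers (f' s) → f t ∈ Subgroup.zpowers (f s)) ∧
      (∀ t, f' t = 1 → f t = 1) := by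
  obtain ⟨R, _, g, hR, hg⟩ := hD.exists_order hp hs M
  refine ⟨Q × R, inferInstance, f.prod g, hQ.prod hp hR, ?_, ?_, ?_⟩
  · rw [MonoidHom.prod_apply, Prod.orderOf, hN, hg]
    exact Nat.lcm_eq_right (pow_dvd_pow p hNM)
  · rintro t ⟨k, hk⟩
    simp only [MonoidHom.prod_apply, Prod.pow_mk, Prod.mk.injEq] at hk
    exact ⟨k, hk.1⟩
  · intro t ht
    simp only [MonoidHom.prod_apply, Prod.mk_eq_one] at ht
    exact ht.1

end Azarov

namespace Azarov

section conj
variable {M S : Type} [CommGroup M] [Group S]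

/-- partial products along an orbit -/
def dd (δ : S → M) (c : S) (i : S) (k : ℕ) : M := ∏ l ∈ Finset.range k, δ (i * c ^ l)

theorem dd_succ (δ : S → M) (c i : S) (k : ℕ) : dd δ c i (k + 1) = dd δ c i k * δ (i * c ^ k) :=
  Finset.prod_range_succ _ _

theorem dd_add (δ : S → M) (c i : S) (k l : ℕ) :
    dd δ c i (k + l) = dd δ c i k * dd δ c (i * c ^ k) l := by
  rw [dd, Finset.prod_range_add]
  simp only [dd, pow_add, mul_assoc]

theorem wr_pow_right (a : Wr M S) (k : ℕ) : (a ^ k).right = a.right ^ k :=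
  map_pow (SemidirectProduct.rightHom : Wr M S →* S) a k

theorem wr_pow_left (a : Wr M S) (k : ℕ) (i : S) : (a ^ k).left i = dd a.left a.right i k := by
  induction k with
  | zero => simp [dd]
  | succ k ih => rw [pow_succ, wr_mul_left, ih, dd_succ, wr_pow_right]

theorem wr_conj [Finite S] (a b : Wr M S) (hr : a.right = b.right)
    (hpow : a ^ orderOf a.right = b ^ orderOf a.right) :
    ∃ t : Wr M S, t * a * t⁻¹ = b := by
  set c := a.right with hc
  set n := orderOf c with hn
  set δ : S → M := fun i => a.left i * (b.left i)⁻¹ with hδ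
  have hn1 : ∀ i, dd δ c i n = 1 := by
    intro i
    have h := congrArg (fun z : Wr M S => z.left i) hpow
    simp only [wr_pow_left, ← hr] at h
    simp only [dd, hδ, Finset.prod_mul_distrib, Finset.prod_inv_distrib] at h ⊢
    rw [mul_inv_eq_one]
    exact h
  have hper : ∀ i, Function.Periodic (dd δ c i) n := by
    intro i k
    rw [dd_add, hn1, mul_one]
  have hmod : ∀ i k k', k % n = k' % n → dd δ c i k = dd δ c i k' := by
    intro i k k' h
    rw [← (hper i).map_mod_nat k, h, (hper i).map_mod_nat k']
  let ρ : S → S := fun i => ((i : S ⧸ Subgroup.zpowers c)).out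
  have hρ : ∀ i, ∃ k : ℕ, i = ρ i * c ^ k := by
    intro i
    have h1 : (ρ i)⁻¹ * i ∈ Subgroup.zpowers c := by
      rw [← QuotientGroup.eq]
      exact Quotient.out_eq' _
    rw [← mem_powers_iff_mem_zpowers] at h1
    obtain ⟨k, hk⟩ := h1
    exact ⟨k, by simp only at hk; rw [hk, mul_inv_cancel_left]⟩
  choose k hk using hρ
  have hρc : ∀ i, ρ (i * c) = ρ i := by
    intro i
    have : ((i * c : S) : S ⧸ Subgroup.zpowers c) = (i : S ⧸ Subgroup.zpowers c) := by
      rw [eq_comm, QuotientGroup.eq]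
      simp
    simp only [ρ, this]
  have key : ∀ i, dd δ c (ρ (i * c)) (k (i * c)) = dd δ c (ρ i) (k i) * δ i := by
    intro i
    rw [hρc]
    have h1 : k (i * c) % n = (k i + 1) % n := by
      have h2 := hk (i * c)
      rw [hρc] at h2
      nth_rw 1 [hk i] at h2
      rw [mul_assoc, mul_left_cancel_iff, ← pow_succ] at h2
      exact (pow_inj_mod.1 h2).symm
    rw [hmod _ _ _ h1, dd_succ, ← hk i]
  refine ⟨⟨fun i => dd δ c (ρ i) (k i), 1⟩, ?_⟩
  rw [mul_inv_eq_iff_eq_mul]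
  apply SemidirectProduct.ext
  · funext i
    rw [wr_mul_left, wr_mul_left]
    simp only [mul_one]
    rw [← hr, key]
    simp only [hδ]
    rw [mul_comm (b.left i), mul_assoc, inv_mul_cancel_right]
  · simp [← hr, hc]

end conj

theorem lift_wr {p : ℕ} {P S : Type} [Group P] [Group S] (f : P →* S) (z : P)
    (hz : ∀ y, Commute y z) (hzp : orderOf z = p) (hker : f.ker = Subgroup.zpowers z) :
    ∃ F : P →* Wr (Multiplicative (ZMod p)) S, Function.Injective F ∧ (∀ x, (F x).right = f x) ∧
      (F z).left = fun _ => Multiplicative.ofAdd 1 := by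
  let ρ : S → S := fun i => ((i : S ⧸ f.range)).out
  have hρ : ∀ i, ∃ x : P, i = ρ i * f x := by
    intro i
    have h1 : (ρ i)⁻¹ * i ∈ f.range := by
      rw [← QuotientGroup.eq]
      exact Quotient.out_eq' _
    obtain ⟨k, hk⟩ := h1
    exact ⟨k, by rw [hk, mul_inv_cancel_left]⟩
  choose τ hτ using hρ
  have hρc : ∀ i x, ρ (i * f x) = ρ i := by
    intro i x
    have : ((i * f x : S) : S ⧸ f.range) = (i : S ⧸ f.range) := by
      rw [eq_comm, QuotientGroup.eq]
      simp
    simp only [ρ, this]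
  have hfτ : ∀ i, f (τ i) = (ρ i)⁻¹ * i := by
    intro i
    rw [eq_inv_mul_iff_mul_eq]
    exact (hτ i).symm
  have hmem : ∀ x i, τ i * x * (τ (i * f x))⁻¹ ∈ Subgroup.zpowers z := by
    intro x i
    rw [← hker, MonoidHom.mem_ker]
    simp only [map_mul, map_inv, hfτ, hρc]
    group
  let F0 : P →* Wr (Subgroup.zpowers z) S :=
    { toFun := fun x => ⟨fun i => ⟨τ i * x * (τ (i * f x))⁻¹, hmem x i⟩, f x⟩
      map_one' := by
        apply SemidirectProduct.ext
        · funext i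
          apply Subtype.ext
          simp
        · simp
      map_mul' := by
        intro x y
        apply SemidirectProduct.ext
        · funext i
          apply Subtype.ext
          rw [wr_mul_left]
          simp [mul_assoc]
        · simp }
  have hg : ∀ x : Subgroup.zpowers z, x ∈ Subgroup.zpowers (⟨z, Subgroup.mem_zpowers z⟩ : Subgroup.zpowers z) := by
    rintro ⟨_, k, rfl⟩
    exact ⟨k, rfl⟩
  have hg' : ∀ x : Multiplicative (ZMod p), x ∈ Subgroup.zpowers (Multiplicative.ofAdd (1 : ZMod p)) := by
    intro x
    refine ⟨(x.toAdd.cast : ℤ), ?_⟩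
    apply Multiplicative.toAdd.injective
    simp
  have ho : orderOf (⟨z, Subgroup.mem_zpowers z⟩ : Subgroup.zpowers z) =
      orderOf (Multiplicative.ofAdd (1 : ZMod p)) := by
    rw [Subgroup.orderOf_mk, hzp, orderOf_ofAdd_eq_addOrderOf, ZMod.addOrderOf_one]
  let Λ := mulEquivOfOrderOfEq hg hg' ho
  refine ⟨(wrMap S Λ.toMonoidHom).comp F0, ?_, fun x => rfl, ?_⟩
  · rw [injective_iff_map_eq_one]
    intro x hx
    have h1 : f x = 1 := congrArg SemidirectProduct.right hx
    have h2 : Λ ⟨τ 1 * x * (τ (1 * f x))⁻¹, hmem x 1⟩ = 1 :=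
      congrArg (fun w : Wr (Multiplicative (ZMod p)) S => w.left 1) hx
    rw [MulEquiv.map_eq_one_iff] at h2
    have h3 := congrArg Subtype.val h2
    simp only [h1, mul_one, OneMemClass.coe_one] at h3
    rw [mul_inv_eq_one] at h3
    simpa using h3
  · funext i
    have h1 : f z = 1 := by
      rw [← MonoidHom.mem_ker, hker]; exact Subgroup.mem_zpowers z
    have h2 : (⟨τ i * z * (τ (i * f z))⁻¹, hmem z i⟩ : Subgroup.zpowers z) =
        ⟨z, Subgroup.mem_zpowers z⟩ := by
      apply Subtype.ext
      simp only [h1, mul_one]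
      rw [(hz (τ i)).eq, mul_inv_cancel_right]
    show Λ ⟨τ i * z * (τ (i * f z))⁻¹, hmem z i⟩ = _
    rw [h2]
    exact mulEquivOfOrderOfEq_apply_gen hg hg' ho

end Azarov

namespace Azarov

/-- the pair of finite `p`-groups can be amalgamated along `c = d` in a finite `p`-group -/
def Amal (p : ℕ) {P Q : Type} [Group P] [Group Q] (c : P) (d : Q) : Prop :=
  ∃ (S : Type) (_ : Group S) (f : P →* S) (g : Q →* S), FinP p S ∧ Function.Injective f ∧
    Function.Injective g ∧ f c = g d

theorem Amal.symm {p : ℕ} {P Q : Type} [Group P] [Group Q] {c : P} {d : Q} (h : Amal p c d) :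
    Amal p d c := by
  obtain ⟨S, i, f, g, h1, h2, h3, h4⟩ := h
  exact ⟨S, i, g, f, h1, h3, h2, h4.symm⟩

theorem gen_of_prime {p : ℕ} (hp : p.Prime) {P : Type} [Group P] {w : P} (hw : orderOf w = p) {i : ℤ}
    (hi : w ^ i ≠ 1) : ∃ b : ℤ, (w ^ i) ^ b = w := by
  have h1 : ¬ (p : ℤ) ∣ i := by
    intro h
    apply hi
    rw [← orderOf_dvd_iff_zpow_eq_one, hw]
    exact h
  have h2 : IsCoprime (p : ℤ) i := (Prime.coprime_iff_not_dvd (Nat.prime_iff_prime_int.1 hp)).2 h1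
  obtain ⟨a, b, hab⟩ := h2
  refine ⟨b, ?_⟩
  have h3 : w ^ (p : ℤ) = 1 := by rw [zpow_natCast, ← hw, pow_orderOf_eq_one]
  calc (w ^ i) ^ b = w ^ (a * p + b * i) := by
        rw [zpow_add, mul_comm a, zpow_mul, h3, one_zpow, one_mul, mul_comm b, zpow_mul]
    _ = w := by rw [hab, zpow_one]

theorem pow_eq_one_of_mem {p : ℕ} (hp : p.Prime) {P : Type} [Group P] {z c : P} (hz : orderOf z = p)
    (hzc : z ∉ Subgroup.zpowers c) {k : ℕ} (h : c ^ k ∈ Subgroup.zpowers z) : c ^ k = 1 := by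
  obtain ⟨j, hj⟩ := h
  simp only at hj
  by_contra hne
  rw [← hj] at hne
  obtain ⟨b, hb⟩ := gen_of_prime hp hz hne
  apply hzc
  rw [← hb, hj]
  exact zpow_mem (Subgroup.npow_mem_zpowers _ _) _

theorem order_mk_one {p : ℕ} (hp : p.Prime) {P : Type} [Group P] {z c : P} (hz : orderOf z = p)
    (hzc : z ∉ Subgroup.zpowers c) [(Subgroup.zpowers z).Normal] :
    orderOf (QuotientGroup.mk' (Subgroup.zpowers z) c) = orderOf c := by
  apply Nat.dvd_antisymm
  · exact orderOf_map_dvd _ _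
  · rw [orderOf_dvd_iff_pow_eq_one]
    apply pow_eq_one_of_mem hp hz hzc
    rw [← QuotientGroup.eq_one_iff, ← QuotientGroup.mk'_apply, map_pow, pow_orderOf_eq_one]

theorem ker_comp_mk {P S : Type} [Group P] [Group S] (N : Subgroup P) [N.Normal] (f : P ⧸ N →* S)
    (hf : Function.Injective f) : (f.comp (QuotientGroup.mk' N)).ker = N := by
  ext x
  rw [MonoidHom.mem_ker, MonoidHom.comp_apply, map_eq_one_iff f hf, QuotientGroup.mk'_apply,
    QuotientGroup.eq_one_iff]

theorem higman_one {p : ℕ} (hp : p.Prime) {P Q : Type} [Group P] [Group Q] {c : P} {d : Q} {z : P}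
    (hz : ∀ y, Commute y z) (hzp : orderOf z = p)
    [(Subgroup.zpowers z).Normal] (ho : orderOf c = orderOf d)
    (h : Amal p (QuotientGroup.mk' (Subgroup.zpowers z) c) d) : Amal p c d := by
  obtain ⟨S, _, f, g, hS, hf, hg, hfg⟩ := h
  have := hS.1
  obtain ⟨F, hF, hFr, -⟩ := lift_wr (f.comp (QuotientGroup.mk' (Subgroup.zpowers z))) z hz hzp
    (ker_comp_mk _ f hf)
  obtain ⟨t, ht⟩ := wr_conj (SemidirectProduct.inr (g d)) (F c)
    (by rw [hFr, SemidirectProduct.right_inr]; exact hfg.symm) (by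
      rw [SemidirectProduct.right_inr, orderOf_injective g hg, ← map_pow, ← map_pow, ← map_pow,
        pow_orderOf_eq_one, ← ho, pow_orderOf_eq_one, map_one, map_one, map_one])
  refine ⟨_, _, F, (MulAut.conj t).toMonoidHom.comp (SemidirectProduct.inr.comp g),
    (finP_zmod1 hp).wr hp hS, hF, ?_, ?_⟩
  · exact (MulAut.conj t).injective.comp (SemidirectProduct.inr_injective.comp hg)
  · rw [← ht]; rfl

theorem higman_two {p : ℕ} (hp : p.Prime) {P Q : Type} [Group P] [Group Q] {c : P} {d : Q} {n : ℕ}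
    (hz : ∀ y, Commute y (c ^ n)) (hzp : orderOf (c ^ n) = p)
    (hz' : ∀ y, Commute y (d ^ n)) (hzp' : orderOf (d ^ n) = p)
    [(Subgroup.zpowers (c ^ n)).Normal] [(Subgroup.zpowers (d ^ n)).Normal]
    (ho : orderOf (QuotientGroup.mk' (Subgroup.zpowers (c ^ n)) c) = n)
    (h : Amal p (QuotientGroup.mk' (Subgroup.zpowers (c ^ n)) c)
      (QuotientGroup.mk' (Subgroup.zpowers (d ^ n)) d)) : Amal p c d := by
  obtain ⟨S, _, f, g, hS, hf, hg, hfg⟩ := h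
  have := hS.1
  obtain ⟨F, hF, hFr, hFz⟩ := lift_wr (f.comp (QuotientGroup.mk' (Subgroup.zpowers (c ^ n)))) _ hz hzp
    (ker_comp_mk _ f hf)
  obtain ⟨G, hG, hGr, hGz⟩ := lift_wr (g.comp (QuotientGroup.mk' (Subgroup.zpowers (d ^ n)))) _ hz' hzp'
    (ker_comp_mk _ g hg)
  have e1 : f (QuotientGroup.mk' (Subgroup.zpowers (c ^ n)) (c ^ n)) = 1 := by
    rw [QuotientGroup.mk'_apply, (QuotientGroup.eq_one_iff _).2 (Subgroup.mem_zpowers _), map_one]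
  have e2 : g (QuotientGroup.mk' (Subgroup.zpowers (d ^ n)) (d ^ n)) = 1 := by
    rw [QuotientGroup.mk'_apply, (QuotientGroup.eq_one_iff _).2 (Subgroup.mem_zpowers _), map_one]
  obtain ⟨t, ht⟩ := wr_conj (F c) (G d) (by rw [hFr, hGr]; exact hfg) (by
    rw [hFr, MonoidHom.comp_apply, orderOf_injective f hf, ho, ← map_pow, ← map_pow]
    apply SemidirectProduct.ext
    · rw [hFz, hGz]
    · rw [hFr, hGr]
      exact e1.trans e2.symm)
  refine ⟨_, _, (MulAut.conj t).toMonoidHom.comp F, G, (finP_zmod1 hp).wr hp hS, ?_, hG, ht⟩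
  exact (MulAut.conj t).injective.comp hF

theorem order_mk_two {p : ℕ} (hp : p.Prime) {P : Type} [Group P] {c : P} {e : ℕ}
    (hc : orderOf c = p ^ (e + 1)) [(Subgroup.zpowers (c ^ p ^ e)).Normal] :
    orderOf (QuotientGroup.mk' (Subgroup.zpowers (c ^ p ^ e)) c) = p ^ e := by
  apply Nat.dvd_antisymm
  · rw [orderOf_dvd_iff_pow_eq_one, ← map_pow, QuotientGroup.mk'_apply, QuotientGroup.eq_one_iff]
    exact Subgroup.mem_zpowers _
  · have h := pow_orderOf_eq_one (QuotientGroup.mk' (Subgroup.zpowers (c ^ p ^ e)) c)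
    rw [← map_pow, QuotientGroup.mk'_apply, QuotientGroup.eq_one_iff] at h
    obtain ⟨j, hj⟩ := h
    simp only at hj
    generalize orderOf (QuotientGroup.mk' (Subgroup.zpowers (c ^ p ^ e)) c) = k at hj ⊢
    have h1 : c ^ (((p ^ e : ℕ) : ℤ) * j - k) = 1 := by
      rw [zpow_sub, zpow_mul, zpow_natCast, zpow_natCast, hj, mul_inv_cancel]
    have h2 := orderOf_dvd_iff_zpow_eq_one.2 h1
    rw [hc] at h2
    have h3 : ((p ^ e : ℕ) : ℤ) ∣ ((p ^ (e + 1) : ℕ) : ℤ) := by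
      exact_mod_cast pow_dvd_pow p (Nat.le_succ e)
    exact Int.natCast_dvd_natCast.1 ((dvd_sub_right (Int.dvd_mul_right _ j)).1 (h3.trans h2))

theorem order_pow_pe {p : ℕ} (hp : p.Prime) {P : Type} [Group P] {c : P} {e : ℕ}
    (hc : orderOf c = p ^ (e + 1)) : orderOf (c ^ p ^ e) = p := by
  rw [orderOf_pow_of_dvd (pow_ne_zero _ hp.ne_zero) (by rw [hc]; exact pow_dvd_pow p (Nat.le_succ e)), hc,
    pow_succ, Nat.mul_div_cancel_left _ (pow_pos hp.pos e)]

theorem central_pow {p : ℕ} (hp : p.Prime) {P : Type} [Group P] (hP : FinP p P) {c : P} {e : ℕ}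
    (hc : orderOf c = p ^ (e + 1))
    (h : ∀ z : P, (∀ y, Commute y z) → orderOf z = p → z ∈ Subgroup.zpowers c) :
    ∀ y, Commute y (c ^ p ^ e) := by
  have hnt : Nontrivial P := by
    refine ⟨c, 1, ?_⟩
    rintro rfl
    rw [orderOf_one] at hc
    have : 1 < p ^ (e + 1) := Nat.one_lt_pow (by omega) hp.one_lt
    omega
  obtain ⟨z, hz, hzp⟩ := central_p hp hP
  obtain ⟨j, hj⟩ := h z hz hzp
  simp only at hj
  have h1 : c ^ (j * p) = 1 := by
    rw [zpow_mul, hj, zpow_natCast, ← hzp, pow_orderOf_eq_one]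
  have h2 := orderOf_dvd_iff_zpow_eq_one.2 h1
  rw [hc] at h2
  have h3 : ((p ^ e : ℕ) : ℤ) ∣ j := by
    have hp0 : (p : ℤ) ≠ 0 := by exact_mod_cast hp.ne_zero
    push_cast at h2 ⊢
    rw [pow_succ] at h2
    exact (mul_dvd_mul_iff_right hp0).1 h2
  obtain ⟨i, rfl⟩ := h3
  rw [zpow_mul, zpow_natCast] at hj
  have hz1 : (c ^ p ^ e) ^ i ≠ 1 := by
    rw [hj]
    rintro rfl
    rw [orderOf_one] at hzp
    exact hp.one_lt.ne hzp
  obtain ⟨b, hb⟩ := gen_of_prime hp (order_pow_pe hp hc) hz1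
  intro y
  rw [← hb, hj]
  exact (hz y).zpow_right b

theorem higman {p : ℕ} (hp : p.Prime) (N : ℕ) : ∀ (P Q : Type) [Group P] [Group Q] (c : P) (d : Q),
    Nat.card P + Nat.card Q = N → FinP p P → FinP p Q → orderOf c = orderOf d → Amal p c d := by
  induction N using Nat.strong_induction_on with
  | _ N ih =>
  intro P Q _ _ c d hN hP hQ ho
  by_cases h1 : ∃ z : P, (∀ y, Commute y z) ∧ orderOf z = p ∧ z ∉ Subgroup.zpowers c
  · obtain ⟨z, hz, hzp, hzc⟩ := h1
    have := normal_of_central hz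
    refine higman_one hp hz hzp ho (ih _ ?_ _ _ _ _ rfl (hP.quotient _) hQ ?_)
    · have := card_quotient_lt hp hP hzp
      omega
    · rw [order_mk_one hp hzp hzc, ho]
  by_cases h2 : ∃ z : Q, (∀ y, Commute y z) ∧ orderOf z = p ∧ z ∉ Subgroup.zpowers d
  · obtain ⟨z, hz, hzp, hzc⟩ := h2
    have := normal_of_central hz
    refine (higman_one hp hz hzp ho.symm (ih _ ?_ _ _ _ _ rfl (hQ.quotient _) hP ?_)).symm
    · have := card_quotient_lt hp hQ hzp
      omega
    · rw [order_mk_one hp hzp hzc, ho]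
  push Not at h1 h2
  obtain ⟨e, he⟩ := hP.orderOf hp c
  rcases e with _ | e
  · have hc : c = 1 := by rw [← orderOf_eq_one_iff, he, pow_zero]
    have hd : d = 1 := by rw [← orderOf_eq_one_iff, ← ho, he, pow_zero]
    refine ⟨P × Q, inferInstance, MonoidHom.inl P Q, MonoidHom.inr P Q, hP.prod hp hQ, ?_, ?_, ?_⟩
    · intro a b h; simpa using h
    · intro a b h; simpa using h
    · rw [hc, hd, map_one, map_one]
  · have he' : orderOf d = p ^ (e + 1) := ho ▸ he
    have c1 := central_pow hp hP he h1
    have c2 := central_pow hp hQ he' h2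
    have := normal_of_central c1
    have := normal_of_central c2
    have o1 := order_mk_two hp he
    have o2 := order_mk_two hp he'
    refine higman_two hp c1 (order_pow_pe hp he) c2 (order_pow_pe hp he') o1
      (ih _ ?_ _ _ _ _ rfl (hP.quotient _) (hQ.quotient _) (o1.trans o2.symm))
    have := card_quotient_lt hp hP (order_pow_pe hp he)
    have := card_quotient_lt hp hQ (order_pow_pe hp he')
    omega

end Azarov

namespace Azarov

/-- induced map to a wreath product -/
def semiWr {N S R : Type} [Group N] [Group S] [Group R] (φ : S →* MulAut N) (ρ : N →* R) :
    N ⋊[φ] S →* Wr R S where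
  toFun x := ⟨fun i => ρ (φ i x.left), x.right⟩
  map_one' := by
    apply SemidirectProduct.ext
    · funext i; simp
    · simp
  map_mul' x y := by
    apply SemidirectProduct.ext
    · funext i
      rw [wr_mul_left]
      simp
    · simp

theorem semi_detect {p : ℕ} (hp : p.Prime) {N S : Type} [Group N] [Group S] (φ : S →* MulAut N)
    (hN : ResP p N) (hS : FinP p S) (x : N ⋊[φ] S) (hx : x.left ≠ 1) :
    ∃ (P : Type) (_ : Group P) (f : N ⋊[φ] S →* P), FinP p P ∧ f x ≠ 1 := by
  obtain ⟨R, _, ρ, hR, h⟩ := hN _ hx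
  refine ⟨_, _, semiWr φ ρ, FinP.wr hp hR hS, fun hh => h ?_⟩
  have := congrFun (congrArg SemidirectProduct.left hh) 1
  simpa [semiWr] using this

theorem Good.map_mem {H B H' B' : Type} [Group H] [Group B] [Group H'] [Group B']
    {C : Subgroup H} {C' : Subgroup B}
    {E : Subgroup H'} {E' : Subgroup B'} (f : H →* H') (g : B →* B') {K : List (H × B)}
    (hf : ∀ s ∈ K, ∀ t ∈ K, f (s.1⁻¹ * t.1) ∈ E → s.1⁻¹ * t.1 ∈ C)
    (hg : ∀ s ∈ K, g s.2 ∈ E' → s.2 ∈ C') (h : Good C C' K) :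
    Good E E' (K.map fun s => (f s.1, g s.2)) := by
  induction K with
  | nil => exact Good.nil _ _
  | cons a K ih =>
    rw [Good_cons] at h
    rw [List.map_cons, Good_cons]
    refine ⟨fun hh => h.1 (hg a (by simp) hh), ?_, ih ?_ ?_ h.2.2⟩
    · intro t ht hh
      rw [List.head?_map] at ht
      obtain ⟨t', ht', rfl⟩ := Option.mem_map.1 ht
      refine h.2.1 t' ht' (hf a (by simp) t' ?_ (by simpa using hh))
      exact List.mem_cons_of_mem _ (List.mem_of_mem_head? ht')
    · intro s hs t ht
      exact hf s (List.mem_cons_of_mem _ hs) t (List.mem_cons_of_mem _ ht)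
    · intro s hs
      exact hg s (List.mem_cons_of_mem _ hs)

theorem amal_core {p : ℕ} (hp : p.Prime) {D B : Type} [Group D] [Group B] {s : D} {c : B}
    (hD : ResP p D) (hB : ResP p B) (hs : ∀ m : ℕ, m ≠ 0 → s ^ m ≠ 1)
    (hc : ∀ m : ℕ, m ≠ 0 → c ^ m ≠ 1)
    {P Q : Type} [Group P] [Group Q] (f : D →* P) (h : B →* Q) (hP : FinP p P) (hQ : FinP p Q) :
    ∃ (S : Type) (_ : Group S) (α : D →* S) (β : B →* S), FinP p S ∧ α s = β c ∧
      (∀ t, α t ∈ Subgroup.zpowers (α s) → f t ∈ Subgroup.zpowers (f s)) ∧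
      (∀ t, β t ∈ Subgroup.zpowers (β c) → h t ∈ Subgroup.zpowers (h c)) ∧
      (∀ t, α t = 1 → f t = 1) := by
  obtain ⟨N, hN⟩ := FinP.orderOf hp hP (f s)
  obtain ⟨M, hM⟩ := FinP.orderOf hp hQ (h c)
  obtain ⟨P', _, f', hP', of', zf', tf'⟩ := enlarge hp hD hs f hP hN (le_max_left N M)
  obtain ⟨Q', _, h', hQ', oh', zh', th'⟩ := enlarge hp hB hc h hQ hM (le_max_right N M)
  obtain ⟨S, _, i, j, hS, hi, hj, hij⟩ := higman hp _ P' Q' (f' s) (h' c) rfl hP' hQ' (of'.trans oh'.symm)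
  refine ⟨S, _, i.comp f', j.comp h', hS, hij, ?_, ?_, ?_⟩
  · rintro t ⟨k, hk⟩
    exact zf' t ⟨k, hi (by simpa using hk)⟩
  · rintro t ⟨k, hk⟩
    exact zh' t ⟨k, hj (by simpa using hk)⟩
  · intro t ht
    exact tf' t (hi (by simpa using ht))

theorem amalg {p : ℕ} (hp : p.Prime) {D B G : Type} [Group D] [Group B] [Group G] {s : D} {c : B}
    (hD : ResP p D) (hB : ResP p B) (hs : ∀ m : ℕ, m ≠ 0 → s ^ m ≠ 1)
    (hc : ∀ m : ℕ, m ≠ 0 → c ^ m ≠ 1) (sD : Sep p s) (sB : Sep p c)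
    (f1 : D →* G) (f2 : B →* G) (e : f1 s = f2 c)
    (gen : Subgroup.closure (Set.range f1 ∪ Set.range f2) = ⊤)
    (univ : ∀ (E : Type) [Group E] (α : D →* E) (β : B →* E), α s = β c →
      ∃ F : G →* E, (∀ d, F (f1 d) = α d) ∧ ∀ b, F (f2 b) = β b) : ResP p G := by
  classical
  intro y hy
  obtain ⟨K, a, hK, rfl⟩ := NF_exists f1 f2 (Subgroup.zpowers s) (Subgroup.zpowers c)
    (by rintro _ ⟨k, rfl⟩; exact ⟨c ^ k, ⟨k, rfl⟩, by simp [e]⟩)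
    (by rintro _ ⟨k, rfl⟩; exact ⟨s ^ k, ⟨k, rfl⟩, by simp [e]⟩) gen y
  by_cases hne : K = []
  · subst hne
    simp only [NF_nil, one_mul] at hy ⊢
    have ha : a ≠ 1 := by rintro rfl; simp at hy
    obtain ⟨P, _, f, hP, hfa⟩ := hD a ha
    obtain ⟨S, _, α, β, hS, hαβ, -, -, hα⟩ := amal_core hp hD hB hs hc f (1 : B →* Multiplicative (ZMod p))
      hP (finP_zmod1 hp)
    obtain ⟨F, F1, F2⟩ := univ S α β hαβ
    exact ⟨S, _, F, hS, fun hh => hfa (hα a (by rw [← F1, hh]))⟩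
  · obtain ⟨P, _, f, hP, hf⟩ := combine hp sD
      (((K ×ˢ K).map fun x => x.1.1⁻¹ * x.2.1).filter fun t => t ∉ Subgroup.zpowers s)
      (by intro t ht; simpa using (List.mem_filter.1 ht).2)
    obtain ⟨Q, _, h, hQ, hh⟩ := combine hp sB (K.map fun x => x.2)
      (by intro t ht; obtain ⟨x, hx, rfl⟩ := List.mem_map.1 ht; exact hK.1 x hx)
    obtain ⟨S, _, α, β, hS, hαβ, zα, zβ, -⟩ := amal_core hp hD hB hs hc f h hP hQ
    have hK' : Good (Subgroup.zpowers (α s)) (Subgroup.zpowers (α s))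
        (K.map fun x => (α x.1, β x.2)) := by
      refine Good.map_mem α β ?_ ?_ hK
      · intro x hx y hy hxy
        by_contra hcon
        refine hf (x.1⁻¹ * y.1) ?_ (zα _ hxy)
        refine List.mem_filter.2 ⟨List.mem_map.2 ⟨(x, y), ?_, rfl⟩, by simpa using hcon⟩
        exact List.mem_product.2 ⟨hx, hy⟩
      · intro x hx hxy
        rw [hαβ] at hxy
        exact absurd (zβ _ hxy) (hh x.2 (List.mem_map.2 ⟨x, hx, rfl⟩))
    obtain ⟨F, F1, F2⟩ := univ (FM (Subgroup.zpowers (α s))) (SemidirectProduct.inr.comp α)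
      ((cz (Subgroup.zpowers (α s))).comp β) (by
        rw [MonoidHom.comp_apply, MonoidHom.comp_apply, ← hαβ,
          cz_of_mem _ _ (Subgroup.mem_zpowers _)])
    have e1 : F.comp f1 = SemidirectProduct.inr.comp α := MonoidHom.ext F1
    have e2 : F.comp f2 = (cz (Subgroup.zpowers (α s))).comp β := MonoidHom.ext F2
    have key : (F (NF f1 f2 K * f1 a)).left ≠ 1 := by
      rw [map_mul, map_NF, e1, e2, NF_map, ← one_mul (NF _ _ _),
        ← map_one (SemidirectProduct.inr : S →* FM (Subgroup.zpowers (α s))), NF_ping, F1]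
      simp only [SemidirectProduct.mul_left, MonoidHom.comp_apply, SemidirectProduct.left_inr,
        map_one, mul_one]
      refine mk_ne_one_of_reduced (pw_reduced _ _ hK' 1) ?_
      rcases K with _ | ⟨t, K⟩
      · exact absurd rfl hne
      · simp [pw]
    obtain ⟨R, _, ψ, hR, hψ⟩ := semi_detect hp _ (resP_free hp _) hS _ key
    exact ⟨R, _, ψ.comp F, hR, hψ⟩

end Azarov

namespace Azarov

theorem mem_range_map {X Z : Type} (i : X → Z) (u : FreeGroup Z)
    (hu : u ∈ Subgroup.closure (Set.range fun x : X => FreeGroup.of (i x))) :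
    ∃ u' : FreeGroup X, FreeGroup.map i u' = u := by
  have : Subgroup.closure (Set.range fun x : X => FreeGroup.of (i x)) ≤ (FreeGroup.map i).range := by
    rw [Subgroup.closure_le]
    rintro _ ⟨x, rfl⟩
    exact ⟨FreeGroup.of x, by simp⟩
  exact this hu

theorem map_mem_closure {X Z : Type} (i : X → Z) (w : FreeGroup X) :
    FreeGroup.map i w ∈ Subgroup.closure (Set.range fun x : X => FreeGroup.of (i x)) := by
  have hw : w ∈ Subgroup.closure (Set.range (FreeGroup.of : X → FreeGroup X)) := by
    rw [FreeGroup.closure_range_of]; trivial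
  have h := Subgroup.mem_map_of_mem (FreeGroup.map i) hw
  rw [MonoidHom.map_closure, ← Set.range_comp] at h
  have e : (FreeGroup.map i ∘ FreeGroup.of) = fun x : X => FreeGroup.of (i x) := by
    funext x; simp
  rwa [e] at h

theorem main_aux {p : ℕ} (hp : p.Prime) {X Y : Type} (u : FreeGroup X) (v : FreeGroup Y)
    (hu : CP u) (hv : v ≠ 1) :
    ResP p (FreeGroup (X ⊕ Y) ⧸ Subgroup.normalClosure
      {FreeGroup.map Sum.inl u * (FreeGroup.map Sum.inr v)⁻¹}) := by
  obtain ⟨w, k, hk, rfl, hw⟩ := exists_root v hv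
  obtain ⟨r, q, hq, rfl⟩ := Nat.exists_eq_pow_mul_and_not_dvd hk.ne' p hp.ne_one
  have hcop : Nat.Coprime p q := (Nat.Prime.coprime_iff_not_dvd hp).2 hq
  have hq0 : 0 < q := Nat.pos_of_ne_zero (by rintro rfl; simp at hq)
  obtain ⟨D, _, κ, s, R⟩ := rootExt_exists hp hcop hq0 u hu
  set L : FreeGroup X →* FreeGroup (X ⊕ Y) := FreeGroup.map Sum.inl with hL
  set M : FreeGroup Y →* FreeGroup (X ⊕ Y) := FreeGroup.map Sum.inr with hM
  set Nn := Subgroup.normalClosure {L u * (M (w ^ (p ^ r * q)))⁻¹} with hNn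
  let π := QuotientGroup.mk' Nn
  have hπ : π (L u) = π (M (w ^ (p ^ r * q))) := by
    have h0 : π (L u * (M (w ^ (p ^ r * q)))⁻¹) = 1 :=
      (QuotientGroup.eq_one_iff _).2 (Subgroup.subset_normalClosure rfl)
    exact mul_inv_eq_one.1 (by simpa only [map_mul, map_inv] using h0)
  obtain ⟨f1, h1, h2⟩ := R.univ _ (π.comp L) (π.comp M (w ^ (p ^ r))) (by
    rw [← map_pow, ← pow_mul, MonoidHom.comp_apply, MonoidHom.comp_apply, hπ])
  refine amalg hp (s := s) (c := w ^ (p ^ r)) (R.resP hp hcop) (resP_free hp Y) ?_ ?_ (R.sep hp hcop)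
    (sep_free hp w hw r) f1 (π.comp M) h2 ?_ ?_
  · intro m hm h
    have := R.s_inf (n := (m : ℤ)) (by rw [zpow_natCast]; exact h)
    exact hm (by exact_mod_cast this)
  · intro m hm h
    rw [← pow_mul, ← zpow_natCast] at h
    refine hw.1 _ ?_ h
    exact_mod_cast mul_ne_zero (pow_ne_zero _ hp.ne_zero) hm
  · have h : (⊤ : Subgroup (FreeGroup (X ⊕ Y))).map π = ⊤ := by
      rw [← MonoidHom.range_eq_map]
      exact MonoidHom.range_eq_top.2 (QuotientGroup.mk'_surjective Nn)
    rw [eq_top_iff, ← h, ← FreeGroup.closure_range_of, MonoidHom.map_closure, Subgroup.closure_le]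
    rintro _ ⟨_, ⟨x | x, rfl⟩, rfl⟩
    · exact Subgroup.subset_closure (Or.inl ⟨κ (FreeGroup.of x), by rw [h1]; simp [hL]⟩)
    · exact Subgroup.subset_closure (Or.inr ⟨FreeGroup.of x, by simp [hM]⟩)
  · intro E _ α β hαβ
    let Φ : FreeGroup (X ⊕ Y) →* E :=
      FreeGroup.lift (Sum.elim (fun x => α (κ (FreeGroup.of x))) (fun y => β (FreeGroup.of y)))
    have e1 : Φ.comp L = α.comp κ := by
      ext x; simp [Φ, hL]
    have e2 : Φ.comp M = β := by
      ext x; simp [Φ, hM]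
    have e1' : ∀ x, Φ (L x) = α (κ x) := fun x => DFunLike.congr_fun e1 x
    have e2' : ∀ x, Φ (M x) = β x := fun x => DFunLike.congr_fun e2 x
    have hker : Nn ≤ Φ.ker := by
      apply Subgroup.normalClosure_le_normal
      rw [Set.singleton_subset_iff]
      show Φ _ = 1
      rw [map_mul, map_inv, mul_inv_eq_one, e1', e2', ← R.pow, map_pow, hαβ, ← map_pow, ← pow_mul]
    let F := QuotientGroup.lift Nn Φ hker
    have F2 : ∀ b, F (π.comp M b) = β b := fun b => e2' b
    refine ⟨F, ?_, F2⟩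
    have : F.comp f1 = α := by
      refine MonoidHom.eq_of_eqOn_dense R.gen ?_
      rintro _ (⟨h, rfl⟩ | rfl)
      · show F (f1 (κ h)) = _
        rw [h1]; exact e1' h
      · show F (f1 _) = _
        rw [h2, F2, hαβ]
    exact fun d => DFunLike.congr_fun this d

end Azarov

theorem residually_finite_p_group_one_relator
    (m n : ℕ) (hm : 1 ≤ m) (hn : 1 ≤ n)
    (A B : Subgroup (FreeGroup (Fin m ⊕ Fin n)))
    (hA : A = Subgroup.closure (Set.range fun i : Fin m => FreeGroup.of (Sum.inl i)))
    (hB : B = Subgroup.closure (Set.range fun j : Fin n => FreeGroup.of (Sum.inr j)))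
    (u v : FreeGroup (Fin m ⊕ Fin n))
    (huA : u ∈ A)
    (hnp : ¬ ∃ (w : A) (k : ℤ), 2 ≤ k ∧ (⟨u, huA⟩ : A) = w ^ k)
    (hvB : v ∈ B) (hv : v ≠ 1) :
    ∀ p : ℕ, p.Prime →
      ∀ g : FreeGroup (Fin m ⊕ Fin n) ⧸ Subgroup.normalClosure {u * v⁻¹}, g ≠ 1 →
        ∃ (N : Subgroup (FreeGroup (Fin m ⊕ Fin n) ⧸ Subgroup.normalClosure {u * v⁻¹}))
          (hN : N.Normal), g ∉ N ∧
          Finite ((FreeGroup (Fin m ⊕ Fin n) ⧸ Subgroup.normalClosure {u * v⁻¹}) ⧸ N) ∧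
          (letI := hN
           IsPGroup p ((FreeGroup (Fin m ⊕ Fin n) ⧸ Subgroup.normalClosure {u * v⁻¹}) ⧸ N)) := by
  intro p hp g hg
  subst hA hB
  obtain ⟨u', rfl⟩ := Azarov.mem_range_map _ _ huA
  obtain ⟨v', rfl⟩ := Azarov.mem_range_map _ _ hvB
  have hu : Azarov.CP u' := by
    refine Azarov.CP_of_not_power _ ?_
    rintro ⟨w, k, hk, rfl⟩
    exact hnp ⟨⟨FreeGroup.map Sum.inl w, Azarov.map_mem_closure _ w⟩, k, hk, by
      apply Subtype.ext; simp⟩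
  have hv' : v' ≠ 1 := by rintro rfl; simp at hv
  obtain ⟨P, _, φ, ⟨hP1, hP2⟩, hφ⟩ := Azarov.main_aux hp u' v' hu hv' g hg
  refine ⟨φ.ker, inferInstance, hφ, ?_, ?_⟩
  · exact Finite.of_injective _ (QuotientGroup.kerLift_injective φ)
  · exact hP2.of_injective _ (QuotientGroup.kerLift_injective φ)
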